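/- arXiv:2604.11346 — 6 statements merged into one kernel-verified Lean document; each statement's English description precedes it below -/
import Mathlib

section
/- Under the standing assumptions on G₀, the restriction of G₀ to the interior of 𝒳 is a C¹ diffeomorphism onto its image G₀(int 𝒳): it is injective, its Jacobian DG₀(x) is invertible at every x ∈ int 𝒳, the image G₀(int 𝒳) is open, and the inverse map is C¹. Consequently, setting 𝒫 = −G₀(int 𝒳), the map x* : 𝒫 → int 𝒳 defined by x*(p) = G₀⁻¹(−p) is a C¹ diffeomorphism and, for every p ∈ 𝒫, x*(p) is the unique point x ∈ 𝒳 satisfying the variational inequality (G₀(x) + p)ᵀ(y − x) ≥ 0 for all y ∈ 𝒳. -/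
open scoped RealInnerProductSpace

/-- Symmetrization `(T + Tᵀ)/2` of a continuous linear map on Euclidean space. -/
noncomputable def symCLM {n : ℕ}
    (T : EuclideanSpace ℝ (Fin n) →L[ℝ] EuclideanSpace ℝ (Fin n)) :
    EuclideanSpace ℝ (Fin n) →L[ℝ] EuclideanSpace ℝ (Fin n) :=
  (1 / 2 : ℝ) • (T + ContinuousLinearMap.adjoint T)

open Set Function

section InverseFunction

variable {E F : Type*} [NormedAddCommGroup E] [NormedSpace ℝ E] [CompleteSpace E]
  [NormedAddCommGroup F] [NormedSpace ℝ F]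
  {f : E → F} {f' : E → E ≃L[ℝ] F} {s : Set E}

theorem isOpen_image_of_hasStrictFDerivAt_equiv (hs : IsOpen s)
    (hf : ∀ x ∈ s, HasStrictFDerivAt f (f' x : E →L[ℝ] F) x) : IsOpen (f '' s) := by
  rw [isOpen_iff_mem_nhds]
  rintro _ ⟨x, hx, rfl⟩
  rw [← (hf x hx).map_nhds_eq_of_equiv]
  exact Filter.image_mem_map (hs.mem_nhds hx)

/-- The inverse of an injective `C¹` map with invertible derivatives on an open set is `C¹`. -/
theorem contDiffOn_invFunOn_of_hasStrictFDerivAt_equiv (hs : IsOpen s) (hinj : InjOn f s)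
    (hf : ∀ x ∈ s, HasStrictFDerivAt f (f' x : E →L[ℝ] F) x)
    (hf₁ : ∀ x ∈ s, ContDiffAt ℝ 1 f x) :
    ContDiffOn ℝ 1 (invFunOn f s) (f '' s) := by
  have hopen : IsOpenMap (s.domRestrict f) := by
    intro V hV
    have hV' : IsOpen (Subtype.val '' V : Set E) := hs.isOpenMap_subtype_val V hV
    have himage : s.domRestrict f '' V = f '' (Subtype.val '' V) := by
      rw [image_image]; rfl
    rw [himage]
    refine isOpen_image_of_hasStrictFDerivAt_equiv hV' fun x hx => hf x ?_
    obtain ⟨y, -, rfl⟩ := hx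
    exact y.2
  let e : OpenPartialHomeomorph E F :=
    OpenPartialHomeomorph.ofContinuousOpenRestrict (hinj.toPartialEquiv f s)
      (fun x hx => (hf x hx).continuousAt.continuousWithinAt) hopen hs
  intro y hy
  have hx : e.symm y ∈ s := e.map_target hy
  exact (e.contDiffAt_symm hy (hf _ hx).hasFDerivAt (hf₁ _ hx)).contDiffWithinAt

end InverseFunction

section Monotone

variable {E : Type*} [NormedAddCommGroup E] [InnerProductSpace ℝ E]

theorem Convex.inner_sub_ge_of_hasFDerivAt {s : Set E} (hs : Convex ℝ s) {f : E → E}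
    {f' : E → E →L[ℝ] E} (hf : ∀ x ∈ s, HasFDerivAt f (f' x) x) {c : ℝ}
    (hc : ∀ x ∈ s, ∀ w, c * ‖w‖ ^ 2 ≤ ⟪w, f' x w⟫) {x y : E} (hx : x ∈ s) (hy : y ∈ s) :
    c * ‖y - x‖ ^ 2 ≤ ⟪y - x, f y - f x⟫ := by
  have hderiv : ∀ z ∈ s, HasFDerivWithinAt (fun z => ⟪y - x, f z⟫)
      ((innerSL ℝ (y - x)).comp (f' z)) s z := fun z hz =>
    ((innerSL ℝ (y - x)).hasFDerivAt.comp z (hf z hz)).hasFDerivWithinAt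
  obtain ⟨z, hz, hzeq⟩ := domain_mvt hderiv hs hx hy
  rw [inner_sub_right, hzeq]
  exact hc z (hs.segment_subset hx hy hz) (y - x)

theorem ContinuousLinearMap.bijective_of_coercive [FiniteDimensional ℝ E] {T : E →L[ℝ] E} {c : ℝ}
    (hc : 0 < c) (hT : ∀ w, c * ‖w‖ ^ 2 ≤ ⟪w, T w⟫) : Bijective T := by
  have hinj : Injective (T : E →ₗ[ℝ] E) := by
    rw [injective_iff_map_eq_zero]
    intro w hw
    replace hw : T w = 0 := hw
    have h := hT w
    rw [hw, inner_zero_right] at h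
    by_contra hne
    have := norm_pos_iff.mpr hne
    exact h.not_gt (by positivity)
  exact ⟨hinj, LinearMap.injective_iff_surjective.mp hinj⟩

theorem eq_of_variational_inequality {s : Set E} {f : E → E} {c : ℝ} (hc : 0 < c)
    (hf : ∀ x ∈ s, ∀ y ∈ s, c * ‖y - x‖ ^ 2 ≤ ⟪y - x, f y - f x⟫) {p x y : E}
    (hx : x ∈ s) (hy : y ∈ s) (hxs : ∀ z ∈ s, 0 ≤ ⟪f x + p, z - x⟫)
    (hys : ∀ z ∈ s, 0 ≤ ⟪f y + p, z - y⟫) : x = y := by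
  have h₁ := hxs y hy
  have h₂ := hys x hx
  have h₃ := hf x hx y hy
  have h₄ : ⟪f x + p, y - x⟫ + ⟪f y + p, x - y⟫ = -⟪y - x, f y - f x⟫ := by
    rw [← neg_sub y x, inner_neg_right, ← sub_eq_add_neg, ← inner_sub_left, ← inner_neg_right,
      real_inner_comm]
    congr 1
    abel
  by_contra hne
  have := norm_pos_iff.mpr (sub_ne_zero.mpr (Ne.symm hne))
  have : 0 < c * ‖y - x‖ ^ 2 := by positivity
  linarith

end Monotone

theorem inner_symCLM {n : ℕ} (T : EuclideanSpace ℝ (Fin n) →L[ℝ] EuclideanSpace ℝ (Fin n))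
    (w : EuclideanSpace ℝ (Fin n)) : ⟪w, symCLM T w⟫ = ⟪w, T w⟫ := by
  have h : symCLM T w = (1 / 2 : ℝ) • (T w + ContinuousLinearMap.adjoint T w) := rfl
  rw [h, inner_smul_right, inner_add_right, ContinuousLinearMap.adjoint_inner_right,
    real_inner_comm]
  ring

theorem stmt1 {n : ℕ} (a b : Fin n → ℝ) (hab : ∀ i, a i < b i)
    (𝒳 : Set (EuclideanSpace ℝ (Fin n)))
    (h𝒳 : 𝒳 = {x : EuclideanSpace ℝ (Fin n) | ∀ i, x i ∈ Set.Icc (a i) (b i)})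
    (G₀ : EuclideanSpace ℝ (Fin n) → EuclideanSpace ℝ (Fin n))
    (DG₀ : EuclideanSpace ℝ (Fin n) →
      EuclideanSpace ℝ (Fin n) →L[ℝ] EuclideanSpace ℝ (Fin n))
    (U : Set (EuclideanSpace ℝ (Fin n))) (hU : IsOpen U) (hXU : 𝒳 ⊆ U)
    (hG₀ : ∀ x ∈ U, HasFDerivAt G₀ (DG₀ x) x)
    (hDG₀cont : ContinuousOn DG₀ U)
    (m : ℝ) (hm : 0 < m)
    (hsym : ∀ x ∈ 𝒳, ∀ w, ⟪w, symCLM (DG₀ x) w⟫ ≥ m / 2 * ‖w‖ ^ 2) :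
    -- `G₀` restricted to `int 𝒳` is injective,
    Set.InjOn G₀ (interior 𝒳) ∧
    -- its Jacobian is invertible at every interior point,
    (∀ x ∈ interior 𝒳, Function.Bijective (DG₀ x)) ∧
    -- the image `G₀(int 𝒳)` is open,
    IsOpen (G₀ '' interior 𝒳) ∧
    -- and, with `𝒫 = −G₀(int 𝒳)`, the response map `x* = G₀⁻¹ ∘ (-·)` is a `C¹`
    -- diffeomorphism from `𝒫` onto `int 𝒳` whose value at `p` is the unique
    -- solution in `𝒳` of the variational inequality.
    ∃ xstar : EuclideanSpace ℝ (Fin n) → EuclideanSpace ℝ (Fin n),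
      Set.BijOn xstar ((fun x => -G₀ x) '' interior 𝒳) (interior 𝒳) ∧
      ContDiffOn ℝ 1 xstar ((fun x => -G₀ x) '' interior 𝒳) ∧
      (∀ p ∈ (fun x => -G₀ x) '' interior 𝒳, G₀ (xstar p) = -p) ∧
      (∀ x ∈ interior 𝒳, xstar (-G₀ x) = x) ∧
      (∀ p ∈ (fun x => -G₀ x) '' interior 𝒳,
        xstar p ∈ 𝒳 ∧
        (∀ y ∈ 𝒳, ⟪G₀ (xstar p) + p, y - xstar p⟫ ≥ 0) ∧
        ∀ x ∈ 𝒳, (∀ y ∈ 𝒳, ⟪G₀ x + p, y - x⟫ ≥ 0) → x = xstar p) := by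
  have hcoer : ∀ x ∈ 𝒳, ∀ w, m / 2 * ‖w‖ ^ 2 ≤ ⟪w, DG₀ x w⟫ := fun x hx w =>
    inner_symCLM (DG₀ x) w ▸ hsym x hx w
  have hc : 0 < m / 2 := half_pos hm
  have hconv : Convex ℝ 𝒳 := by
    have h : 𝒳 = (fun x : EuclideanSpace ℝ (Fin n) => WithLp.linearEquiv 2 ℝ (Fin n → ℝ) x) ⁻¹'
        univ.pi fun i => Icc (a i) (b i) := by
      rw [h𝒳]
      ext x
      simp [Pi.le_def, forall_and]
    rw [h]
    exact (convex_pi fun i _ => convex_Icc (a i) (b i)).linear_preimage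
      (WithLp.linearEquiv 2 ℝ (Fin n → ℝ)).toLinearMap
  have hmono : ∀ x ∈ 𝒳, ∀ y ∈ 𝒳, m / 2 * ‖y - x‖ ^ 2 ≤ ⟪y - x, G₀ y - G₀ x⟫ :=
    fun x hx y hy => hconv.inner_sub_ge_of_hasFDerivAt (fun z hz => hG₀ z (hXU hz)) hcoer hx hy
  have hsub : interior 𝒳 ⊆ 𝒳 := interior_subset
  have hinj : InjOn G₀ (interior 𝒳) := fun x hx y hy hxy =>
    eq_of_variational_inequality hc hmono (p := -G₀ x) (hsub hx) (hsub hy) (by simp)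
      (by simp [hxy])
  have hbij : ∀ x ∈ interior 𝒳, Bijective (DG₀ x) := fun x hx =>
    ContinuousLinearMap.bijective_of_coercive hc (hcoer x (hsub hx))
  have hequiv : ∀ x, ∃ e : EuclideanSpace ℝ (Fin n) ≃L[ℝ] EuclideanSpace ℝ (Fin n),
      x ∈ interior 𝒳 → (e : _ →L[ℝ] _) = DG₀ x := by
    intro x
    by_cases hx : x ∈ interior 𝒳
    · exact ⟨ContinuousLinearEquiv.ofBijective (DG₀ x)
        (LinearMap.ker_eq_bot.mpr (hbij x hx).1) (LinearMap.range_eq_top.mpr (hbij x hx).2),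
        fun _ => ContinuousLinearEquiv.coe_ofBijective _ _ _⟩
    · exact ⟨ContinuousLinearEquiv.refl ℝ _, fun h => absurd h hx⟩
  choose e he using hequiv
  have hstrict : ∀ x ∈ interior 𝒳,
      HasStrictFDerivAt G₀ (e x : EuclideanSpace ℝ (Fin n) →L[ℝ] EuclideanSpace ℝ (Fin n)) x := by
    intro x hx
    have hUx : U ∈ nhds x := hU.mem_nhds (hXU (hsub hx))
    rw [he x hx]
    exact hasStrictFDerivAt_of_hasFDerivAt_of_continuousAt
      (Filter.eventually_of_mem hUx hG₀) (hDG₀cont.continuousAt hUx)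
  have hcd : ∀ x ∈ interior 𝒳, ContDiffAt ℝ 1 G₀ x := fun x hx =>
    contDiffAt_one_iff.mpr ⟨DG₀, U, hU.mem_nhds (hXU (hsub hx)), hDG₀cont, hG₀⟩
  have hinv : ∀ x ∈ interior 𝒳, invFunOn G₀ (interior 𝒳) (G₀ x) = x := fun x hx =>
    hinj.leftInvOn_invFunOn hx
  refine ⟨hinj, hbij, isOpen_image_of_hasStrictFDerivAt_equiv isOpen_interior hstrict,
    fun p => invFunOn G₀ (interior 𝒳) (-p), ⟨?_, ?_, ?_⟩, ?_, ?_, ?_, ?_⟩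
  · rintro _ ⟨x, hx, rfl⟩
    simpa [hinv x hx] using hx
  · rintro _ ⟨x, hx, rfl⟩ _ ⟨y, hy, rfl⟩ hxy
    simp only [neg_neg, hinv x hx, hinv y hy] at hxy
    simp [hxy]
  · intro x hx
    exact ⟨-G₀ x, ⟨x, hx, rfl⟩, by simpa using hinv x hx⟩
  · refine (contDiffOn_invFunOn_of_hasStrictFDerivAt_equiv isOpen_interior hinj hstrict hcd).comp
      contDiff_neg.contDiffOn ?_
    rintro _ ⟨x, hx, rfl⟩
    exact ⟨x, hx, (neg_neg _).symm⟩
  · rintro _ ⟨x, hx, rfl⟩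
    simp [hinv x hx]
  · intro x hx
    simpa using hinv x hx
  · rintro _ ⟨x, hx, rfl⟩
    simp only [neg_neg, hinv x hx]
    refine ⟨hsub hx, by simp, fun y hy hy' => ?_⟩
    exact eq_of_variational_inequality hc hmono hy (hsub hx) hy' (by simp)
end

section
/- Under the standing assumptions on G₀ (symmetrized-Jacobian lower bound with constant m/2 on 𝒳, and DG₀ being L₁-Lipschitz on 𝒳 in the spectral norm), the Jacobian of the response map, Dx*(p) = −(DG₀(x*(p)))⁻¹, is (8L₁/m³)-Lipschitz on 𝒫: for all p₁, p₂ ∈ 𝒫, ‖(DG₀(x*(p₁)))⁻¹ − (DG₀(x*(p₂)))⁻¹‖₂ ≤ (8L₁/m³)‖p₁ − p₂‖. -/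
open scoped RealInnerProductSpace Matrix

/-- Symmetrization `(A + Aᵀ)/2` of a square real matrix. -/
noncomputable def symMat {n : ℕ} (A : Matrix (Fin n) (Fin n) ℝ) : Matrix (Fin n) (Fin n) ℝ :=
  (1 / 2 : ℝ) • (A + Aᵀ)

/-- The action of a matrix on Euclidean space. -/
noncomputable def mApply {n : ℕ} (A : Matrix (Fin n) (Fin n) ℝ)
    (w : EuclideanSpace ℝ (Fin n)) : EuclideanSpace ℝ (Fin n) :=
  Matrix.toEuclideanCLM (𝕜 := ℝ) A w

/-- The spectral norm (operator 2-norm) of a square real matrix. -/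
noncomputable def specNorm {n : ℕ} (A : Matrix (Fin n) (Fin n) ℝ) : ℝ :=
  ‖(Matrix.toEuclideanCLM (𝕜 := ℝ) A :
      EuclideanSpace ℝ (Fin n) →L[ℝ] EuclideanSpace ℝ (Fin n))‖

theorem inner_mApply_symMat {n : ℕ} (A : Matrix (Fin n) (Fin n) ℝ)
    (w : EuclideanSpace ℝ (Fin n)) :
    ⟪w, mApply (symMat A) w⟫ = ⟪w, Matrix.toEuclideanCLM (𝕜 := ℝ) A w⟫ := by
  have hT : Matrix.toEuclideanCLM (𝕜 := ℝ) Aᵀ = star (Matrix.toEuclideanCLM (𝕜 := ℝ) A) := by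
    rw [← map_star, Matrix.star_eq_conjTranspose, Matrix.conjTranspose_eq_transpose_of_trivial]
  have h : ⟪w, Matrix.toEuclideanCLM (𝕜 := ℝ) Aᵀ w⟫ =
      ⟪w, Matrix.toEuclideanCLM (𝕜 := ℝ) A w⟫ := by
    rw [hT, ContinuousLinearMap.star_eq_adjoint, ContinuousLinearMap.adjoint_inner_right,
      real_inner_comm]
  simp only [mApply, symMat, map_smul, map_add, smul_apply,
    add_apply, inner_smul_right, inner_add_right, h]
  ring

theorem mul_norm_le_of_mul_norm_sq_le_inner {E : Type*} [NormedAddCommGroup E]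
    [InnerProductSpace ℝ E] {c : ℝ} {v w : E} (h : c * ‖w‖ ^ 2 ≤ ⟪w, v⟫) :
    c * ‖w‖ ≤ ‖v‖ := by
  rcases (norm_nonneg w).eq_or_lt with hw | hw
  · simp [← hw]
  · have := real_inner_le_norm w v
    refine le_of_mul_le_mul_left ?_ hw
    linarith

theorem isUnit_of_coercive {n : ℕ} {A : Matrix (Fin n) (Fin n) ℝ} {c : ℝ} (hc : 0 < c)
    (hA : ∀ w, c * ‖w‖ ≤ ‖Matrix.toEuclideanCLM (𝕜 := ℝ) A w‖) : IsUnit A := by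
  rw [← Matrix.mulVec_injective_iff_isUnit]
  refine (injective_iff_map_eq_zero A.mulVecLin).2 fun v hv => ?_
  have h := hA (WithLp.toLp 2 v)
  have hv' : A *ᵥ v = 0 := hv
  rw [Matrix.toEuclideanCLM_toLp, hv', WithLp.toLp_zero, norm_zero] at h
  have h0 : ‖WithLp.toLp 2 v‖ = 0 :=
    le_antisymm (nonpos_of_mul_nonpos_right h hc) (norm_nonneg _)
  simpa using h0

theorem specNorm_inv_le {n : ℕ} {A : Matrix (Fin n) (Fin n) ℝ} {c : ℝ} (hc : 0 < c)
    (hA : ∀ w, c * ‖w‖ ≤ ‖Matrix.toEuclideanCLM (𝕜 := ℝ) A w‖) : specNorm A⁻¹ ≤ c⁻¹ := by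
  refine ContinuousLinearMap.opNorm_le_bound _ (inv_nonneg.2 hc.le) fun v => ?_
  have h := hA (Matrix.toEuclideanCLM (𝕜 := ℝ) A⁻¹ v)
  rw [← mul_apply_eq_comp, ← map_mul, Matrix.mul_nonsing_inv _
    ((Matrix.isUnit_iff_isUnit_det A).1 (isUnit_of_coercive hc hA)), map_one,
    one_apply_eq_self] at h
  rwa [inv_mul_eq_div, le_div_iff₀' hc]

theorem specNorm_mul_le {n : ℕ} (A B : Matrix (Fin n) (Fin n) ℝ) :
    specNorm (A * B) ≤ specNorm A * specNorm B := by
  simp only [specNorm, map_mul]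
  exact norm_mul_le _ _

theorem specNorm_inv_sub_inv_le {n : ℕ} {A B : Matrix (Fin n) (Fin n) ℝ} {c : ℝ} (hc : 0 < c)
    (hA : ∀ w, c * ‖w‖ ≤ ‖Matrix.toEuclideanCLM (𝕜 := ℝ) A w‖)
    (hB : ∀ w, c * ‖w‖ ≤ ‖Matrix.toEuclideanCLM (𝕜 := ℝ) B w‖) :
    specNorm (A⁻¹ - B⁻¹) ≤ c⁻¹ * specNorm (B - A) * c⁻¹ := by
  have hiff : IsUnit A ↔ IsUnit B :=
    iff_of_true (isUnit_of_coercive hc hA) (isUnit_of_coercive hc hB)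
  have hnn (M : Matrix (Fin n) (Fin n) ℝ) : 0 ≤ specNorm M := norm_nonneg _
  rw [Matrix.inv_sub_inv hiff]
  calc specNorm (A⁻¹ * (B - A) * B⁻¹)
      ≤ specNorm A⁻¹ * specNorm (B - A) * specNorm B⁻¹ :=
        (specNorm_mul_le _ _).trans
          (mul_le_mul_of_nonneg_right (specNorm_mul_le _ _) (hnn _))
    _ ≤ c⁻¹ * specNorm (B - A) * c⁻¹ :=
        mul_le_mul
          (mul_le_mul_of_nonneg_right (specNorm_inv_le hc hA) (hnn _))
          (specNorm_inv_le hc hB) (hnn _) (mul_nonneg (inv_nonneg.2 hc.le) (hnn _))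

theorem Convex.mul_norm_sub_sq_le_inner {E : Type*} [NormedAddCommGroup E]
    [InnerProductSpace ℝ E] {s : Set E} (hs : Convex ℝ s) {f : E → E} {f' : E → E →L[ℝ] E}
    (hf : ∀ x ∈ s, HasFDerivAt f (f' x) x) {c : ℝ}
    (hf' : ∀ x ∈ s, ∀ w, c * ‖w‖ ^ 2 ≤ ⟪w, f' x w⟫) {x y : E} (hx : x ∈ s) (hy : y ∈ s) :
    c * ‖y - x‖ ^ 2 ≤ ⟪y - x, f y - f x⟫ := by
  have hmem (t : ℝ) (ht : t ∈ Set.Icc (0 : ℝ) 1) : AffineMap.lineMap x y t ∈ s :=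
    hs.lineMap_mem hx hy ht
  have hd (t : ℝ) (ht : t ∈ Set.Icc (0 : ℝ) 1) :
      HasDerivAt (fun t : ℝ => ⟪y - x, f (AffineMap.lineMap x y t)⟫)
        ⟪y - x, f' (AffineMap.lineMap x y t) (y - x)⟫ t := by
    have := (innerSL ℝ (y - x)).hasFDerivAt.comp_hasDerivAt t
      ((hf _ (hmem t ht)).comp_hasDerivAt t AffineMap.hasDerivAt_lineMap)
    exact this
  obtain ⟨t, ht, h⟩ := exists_hasDerivAt_eq_slope _ _ zero_lt_one
    (fun t ht => (hd t ht).continuousAt.continuousWithinAt)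
    fun t ht => hd t (Set.Ioo_subset_Icc_self ht)
  have := hf' _ (hmem t (Set.Ioo_subset_Icc_self ht)) (y - x)
  rw [h] at this
  simpa [inner_sub_right] using this

theorem stmt7 {n : ℕ} (a b : Fin n → ℝ) (hab : ∀ i, a i < b i)
    (𝒳 : Set (EuclideanSpace ℝ (Fin n)))
    (h𝒳 : 𝒳 = {x : EuclideanSpace ℝ (Fin n) | ∀ i, x i ∈ Set.Icc (a i) (b i)})
    (G₀ : EuclideanSpace ℝ (Fin n) → EuclideanSpace ℝ (Fin n))
    (DG₀ : EuclideanSpace ℝ (Fin n) → Matrix (Fin n) (Fin n) ℝ)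
    (U : Set (EuclideanSpace ℝ (Fin n))) (hU : IsOpen U) (hXU : 𝒳 ⊆ U)
    (hG₀ : ∀ x ∈ U, HasFDerivAt G₀
      (Matrix.toEuclideanCLM (𝕜 := ℝ) (DG₀ x) :
        EuclideanSpace ℝ (Fin n) →L[ℝ] EuclideanSpace ℝ (Fin n)) x)
    (m : ℝ) (hm : 0 < m)
    (hsym : ∀ x ∈ 𝒳, ∀ w : EuclideanSpace ℝ (Fin n),
      ⟪w, mApply (symMat (DG₀ x)) w⟫ ≥ m / 2 * ‖w‖ ^ 2)
    (L₁ : ℝ) (hL₁ : 0 < L₁)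
    (hlip : ∀ x ∈ 𝒳, ∀ y ∈ 𝒳, specNorm (DG₀ x - DG₀ y) ≤ L₁ * ‖x - y‖)
    -- `x*` is the response map: the inverse of `x ↦ −G₀(x)` from `int 𝒳` onto `𝒫`
    (xstar : EuclideanSpace ℝ (Fin n) → EuclideanSpace ℝ (Fin n))
    (hmaps : Set.MapsTo xstar ((fun x => -G₀ x) '' interior 𝒳) (interior 𝒳))
    (hinv₁ : ∀ p ∈ (fun x => -G₀ x) '' interior 𝒳, G₀ (xstar p) = -p)
    (hinv₂ : ∀ x ∈ interior 𝒳, xstar (-G₀ x) = x) :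
    ∀ p₁ ∈ (fun x => -G₀ x) '' interior 𝒳,
      ∀ p₂ ∈ (fun x => -G₀ x) '' interior 𝒳,
        specNorm ((DG₀ (xstar p₁))⁻¹ - (DG₀ (xstar p₂))⁻¹) ≤
          8 * L₁ / m ^ 3 * ‖p₁ - p₂‖ := by
  have hconv : Convex ℝ 𝒳 := by
    have : 𝒳 = ⋂ i, EuclideanSpace.proj (𝕜 := ℝ) i ⁻¹' Set.Icc (a i) (b i) := by
      ext x
      simp [h𝒳]
    rw [this]
    exact convex_iInter fun i =>
      (convex_Icc (a i) (b i)).linear_preimage (EuclideanSpace.proj (𝕜 := ℝ) i).toLinearMap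
  have hcoer : ∀ x ∈ 𝒳, ∀ w, m / 2 * ‖w‖ ^ 2 ≤
      ⟪w, Matrix.toEuclideanCLM (𝕜 := ℝ) (DG₀ x) w⟫ := fun x hx w =>
    inner_mApply_symMat (DG₀ x) w ▸ hsym x hx w
  have hbd : ∀ x ∈ 𝒳, ∀ w, m / 2 * ‖w‖ ≤ ‖Matrix.toEuclideanCLM (𝕜 := ℝ) (DG₀ x) w‖ :=
    fun x hx w => mul_norm_le_of_mul_norm_sq_le_inner (hcoer x hx w)
  intro p₁ hp₁ p₂ hp₂
  have hx₁ := interior_subset (hmaps hp₁)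
  have hx₂ := interior_subset (hmaps hp₂)
  have hm2 : 0 < m / 2 := half_pos hm
  have hx : m / 2 * ‖xstar p₂ - xstar p₁‖ ≤ ‖p₁ - p₂‖ := by
    have := mul_norm_le_of_mul_norm_sq_le_inner
      (hconv.mul_norm_sub_sq_le_inner (fun x hx => hG₀ x (hXU hx)) hcoer hx₁ hx₂)
    rwa [hinv₁ p₁ hp₁, hinv₁ p₂ hp₂, neg_sub_neg] at this
  calc specNorm ((DG₀ (xstar p₁))⁻¹ - (DG₀ (xstar p₂))⁻¹)
      ≤ (m / 2)⁻¹ * specNorm (DG₀ (xstar p₂) - DG₀ (xstar p₁)) * (m / 2)⁻¹ :=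
        specNorm_inv_sub_inv_le hm2 (hbd _ hx₁) (hbd _ hx₂)
    _ ≤ (m / 2)⁻¹ * (L₁ * ((m / 2)⁻¹ * ‖p₁ - p₂‖)) * (m / 2)⁻¹ := by
        gcongr
        refine (hlip _ hx₂ _ hx₁).trans ?_
        gcongr
        rwa [inv_mul_eq_div, le_div_iff₀' hm2]
    _ = 8 * L₁ / m ^ 3 * ‖p₁ - p₂‖ := by
        field_simp
        ring
end

section
/- Under the standing assumptions on G₀ and Φ, define c* = min_{x ∈ ∂𝒳} Φ(x) − Φ(x†) > 0 and, for c ≥ 0, the sublevel set 𝒫_c = {p ∈ 𝒫 : Φ(x*(p)) − Φ(x†) ≤ c}. Then for every c with 0 ≤ c < c*, the set 𝒫_c is compact. -/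
open scoped RealInnerProductSpace

theorem stmt10 {n : ℕ} (hn : 0 < n) (a b : Fin n → ℝ) (hab : ∀ i, a i < b i)
    (𝒳 : Set (EuclideanSpace ℝ (Fin n)))
    (h𝒳 : 𝒳 = {x : EuclideanSpace ℝ (Fin n) | ∀ i, x i ∈ Set.Icc (a i) (b i)})
    (G₀ : EuclideanSpace ℝ (Fin n) → EuclideanSpace ℝ (Fin n))
    (DG₀ : EuclideanSpace ℝ (Fin n) →
      EuclideanSpace ℝ (Fin n) →L[ℝ] EuclideanSpace ℝ (Fin n))
    (U : Set (EuclideanSpace ℝ (Fin n))) (hU : IsOpen U) (hXU : 𝒳 ⊆ U)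
    (hG₀ : ∀ x ∈ U, HasFDerivAt G₀ (DG₀ x) x)
    (m : ℝ) (hm : 0 < m)
    (hsym : ∀ x ∈ 𝒳, ∀ w, ⟪w, symCLM (DG₀ x) w⟫ ≥ m / 2 * ‖w‖ ^ 2)
    -- `x*` is the response map: the inverse of `x ↦ −G₀(x)` from `int 𝒳` onto `𝒫`
    (xstar : EuclideanSpace ℝ (Fin n) → EuclideanSpace ℝ (Fin n))
    (hmaps : Set.MapsTo xstar ((fun x => -G₀ x) '' interior 𝒳) (interior 𝒳))
    (hinv₁ : ∀ p ∈ (fun x => -G₀ x) '' interior 𝒳, G₀ (xstar p) = -p)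
    (hinv₂ : ∀ x ∈ interior 𝒳, xstar (-G₀ x) = x)
    -- the planner's social cost `Φ`
    (Φ : EuclideanSpace ℝ (Fin n) → ℝ)
    (gradΦ : EuclideanSpace ℝ (Fin n) → EuclideanSpace ℝ (Fin n))
    (hΦ : ∀ x, HasGradientAt Φ (gradΦ x) x)
    (μΦ : ℝ) (hμΦ : 0 < μΦ) (hΦconv : StrongConvexOn 𝒳 μΦ Φ)
    (xdag : EuclideanSpace ℝ (Fin n)) (hxdag : xdag ∈ interior 𝒳)
    (hmin : ∀ x ∈ 𝒳, Φ xdag ≤ Φ x) :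
    0 < sInf ((fun x => Φ x - Φ xdag) '' frontier 𝒳) ∧
    ∀ c : ℝ, 0 ≤ c → c < sInf ((fun x => Φ x - Φ xdag) '' frontier 𝒳) →
      IsCompact {p ∈ (fun x => -G₀ x) '' interior 𝒳 | Φ (xstar p) - Φ xdag ≤ c} := by
  have hX : IsCompact 𝒳 := by
    have h := (EuclideanSpace.equiv (Fin n) ℝ).toHomeomorph.isCompact_preimage.2
      (isCompact_univ_pi fun i => isCompact_Icc (a := a i) (b := b i))
    convert h using 1
    rw [h𝒳]
    ext x
    simp only [Set.mem_preimage, Set.mem_univ_pi]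
    rfl
  have hclosed : IsClosed 𝒳 := hX.isClosed
  have hfsub : frontier 𝒳 ⊆ 𝒳 := hclosed.frontier_subset
  have hfcomp : IsCompact (frontier 𝒳) := hX.of_isClosed_subset isClosed_frontier hfsub
  have hΦcont : Continuous fun x => Φ x - Φ xdag :=
    (continuous_iff_continuousAt.2 fun x => (hΦ x).continuousAt).sub continuous_const
  have hfne : (frontier 𝒳).Nonempty := by
    have : Nonempty (Fin n) := ⟨⟨0, hn⟩⟩
    exact nonempty_frontier_iff.2 ⟨⟨xdag, interior_subset hxdag⟩, hX.ne_univ⟩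
  have himg : IsCompact ((fun x => Φ x - Φ xdag) '' frontier 𝒳) :=
    hfcomp.image hΦcont
  refine ⟨?_, fun c _ hc => ?_⟩
  · obtain ⟨x, hx, hxv⟩ := himg.sInf_mem (hfne.image _)
    rw [← hxv]
    have hxX := hfsub hx
    refine sub_pos.2 (lt_of_le_of_ne (hmin x hxX) fun heq => ?_)
    have hmin_x : IsMinOn Φ 𝒳 x := fun y hy => heq ▸ hmin y hy
    have hxe : x = xdag := (hΦconv.strictConvexOn hμΦ).eq_of_isMinOn hmin_x
      (fun y hy => hmin y hy) hxX (interior_subset hxdag)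
    exact hx.2 (hxe ▸ hxdag)
  · have hK : IsCompact (𝒳 ∩ {x | Φ x - Φ xdag ≤ c}) :=
      hX.inter_right (isClosed_le hΦcont continuous_const)
    have hG : ContinuousOn (fun x => -G₀ x) (𝒳 ∩ {x | Φ x - Φ xdag ≤ c}) := fun x hx =>
      (hG₀ x (hXU hx.1)).continuousAt.neg.continuousWithinAt
    convert hK.image_of_continuousOn hG using 1
    ext p
    constructor
    · rintro ⟨⟨x, hx, rfl⟩, hp⟩
      simp only [hinv₂ x hx] at hp
      exact ⟨x, ⟨interior_subset hx, hp⟩, rfl⟩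
    · rintro ⟨x, ⟨hxX, hxc⟩, rfl⟩
      have hx : x ∈ interior 𝒳 := by
        by_contra hx
        have hle := csInf_le himg.bddBelow
          (Set.mem_image_of_mem (fun x => Φ x - Φ xdag)
            (show x ∈ frontier 𝒳 from ⟨subset_closure hxX, hx⟩))
        exact absurd (hle.trans hxc) (not_le.2 hc)
      refine ⟨⟨x, hx, rfl⟩, ?_⟩
      simp only [hinv₂ x hx]
      exact hxc
end

section
/- Under the standing assumptions on G₀ and Φ, let 0 ≤ c < c* and consider the social-gradient flow ṗ(t) = ∇Φ(x*(p(t))). Then the sublevel set 𝒫_c is forward invariant: every C¹ solution p : [0,∞) → 𝒫 of this ODE with p(0) ∈ 𝒫_c satisfies p(t) ∈ 𝒫_c for all t ≥ 0. Moreover, p† = −G₀(x†) is the unique equilibrium of the flow in 𝒫_c, and every such solution satisfies lim_{t→∞} p(t) = p†. -/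
open scoped RealInnerProductSpace
open Filter Topology

section Helpers

variable {E : Type*} [NormedAddCommGroup E] [InnerProductSpace ℝ E]

theorem hasDerivAt_add_smul (x w : E) (τ : ℝ) : HasDerivAt (fun τ : ℝ => x + τ • w) w τ := by
  simpa using ((hasDerivAt_id τ).smul_const w).const_add x

/-- A map whose derivative is uniformly coercive on a convex set is strongly monotone there. -/
theorem Convex.strongly_monotone_of_coercive_fderiv {s : Set E} (hs : Convex ℝ s) {G : E → E}
    {A : E → E →L[ℝ] E} (hG : ∀ x ∈ s, HasFDerivAt G (A x) x) {k : ℝ}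
    (hk : ∀ x ∈ s, ∀ w, k * ‖w‖ ^ 2 ≤ ⟪A x w, w⟫) {x y : E} (hx : x ∈ s) (hy : y ∈ s) :
    k * ‖y - x‖ ^ 2 ≤ ⟪G y - G x, y - x⟫ := by
  set w := y - x with hw
  have hmem : ∀ τ ∈ Set.Icc (0 : ℝ) 1, x + τ • w ∈ s := fun τ hτ => hs.add_smul_sub_mem hx hy hτ
  have hd : ∀ τ ∈ Set.Icc (0 : ℝ) 1,
      HasDerivAt (fun τ : ℝ => ⟪G (x + τ • w), w⟫) ⟪A (x + τ • w) w, w⟫ τ := by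
    intro τ hτ
    have h := (hG _ (hmem τ hτ)).comp_hasDerivAt τ (hasDerivAt_add_smul x w τ)
    simpa using h.inner ℝ (hasDerivAt_const τ w)
  obtain ⟨τ, hτ, h⟩ := exists_hasDerivAt_eq_slope (fun τ : ℝ => ⟪G (x + τ • w), w⟫)
    (fun τ => ⟪A (x + τ • w) w, w⟫) zero_lt_one
    (fun τ hτ => (hd τ hτ).continuousAt.continuousWithinAt)
    (fun τ hτ => hd τ (Set.Ioo_subset_Icc_self hτ))
  have h1 := hk _ (hmem τ (Set.Ioo_subset_Icc_self hτ)) w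
  have hxy : x + w = y := by simp [hw]
  simp only [one_smul, zero_smul, add_zero, hxy, sub_zero, div_one] at h
  rw [inner_sub_left, ← h]
  exact h1

theorem mul_norm_le_of_mul_sq_le_inner {k : ℝ} {u w : E} (h : k * ‖w‖ ^ 2 ≤ ⟪u, w⟫) :
    k * ‖w‖ ≤ ‖u‖ := by
  rcases (norm_nonneg w).eq_or_lt with h0 | h0
  · rw [← h0]; simp
  · have := h.trans (real_inner_le_norm u w)
    nlinarith

/-- The gradient inequality for convex functions. -/
theorem ConvexOn.inner_gradient_le_sub [CompleteSpace E] {s : Set E} {f : E → ℝ}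
    (hf : ConvexOn ℝ s f) {x y g : E} (hx : x ∈ s) (hy : y ∈ s) (hg : HasGradientAt f g x) :
    ⟪g, y - x⟫ ≤ f y - f x := by
  have hl : HasDerivAt (fun τ : ℝ => f (x + τ • (y - x))) ⟪g, y - x⟫ 0 := by
    have h0 : HasFDerivAt f (InnerProductSpace.toDual ℝ E g) (x + (0 : ℝ) • (y - x)) := by
      simpa using hg.hasFDerivAt
    have h := h0.comp_hasDerivAt 0 (hasDerivAt_add_smul x (y - x) 0)
    rw [InnerProductSpace.toDual_apply_apply] at h
    exact h
  have hc : ConvexOn ℝ (Set.Icc (0 : ℝ) 1) (fun τ : ℝ => f (x + τ • (y - x))) := by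
    refine ⟨convex_Icc 0 1, fun a ha b hb α β hα hβ hαβ => ?_⟩
    have h := hf.2 (hf.1.add_smul_sub_mem hx hy ha) (hf.1.add_smul_sub_mem hx hy hb) hα hβ hαβ
    have e : α • (x + a • (y - x)) + β • (x + b • (y - x)) =
        x + (α • a + β • b) • (y - x) := by
      have : β = 1 - α := by linarith
      subst this
      simp only [smul_eq_mul]
      module
    rwa [e] at h
  have := hc.le_slope_of_hasDerivAt (by simp) (by simp) zero_lt_one hl
  simpa [slope_def_field] using this

/-- If the curve `-G ∘ x` is differentiable and `x` is Lipschitz at `t` with respect to it, then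
`x` is differentiable at `t` as soon as the derivative of `G` there is bounded below. -/
theorem hasDerivWithinAt_of_comp_neg {s : Set ℝ} {G : E → E} {A : E →L[ℝ] E} {x p : ℝ → E}
    {g v : E} {t k : ℝ} (hk : 0 < k) (hG : HasFDerivAt G A (x t))
    (hA : ∀ w, k * ‖w‖ ≤ ‖A w‖) (hp : HasDerivWithinAt p g s t) (hv : A v = -g) (ht : t ∈ s)
    (hGx : ∀ r ∈ s, G (x r) = -p r)
    (hlip : ∀ r ∈ s, k * ‖x r - x t‖ ≤ ‖p r - p t‖) : HasDerivWithinAt x v s t := by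
  rw [hasDerivWithinAt_iff_isLittleO]
  have hO : (fun r => x r - x t) =O[𝓝[s] t] fun r => r - t := by
    refine Asymptotics.IsBigO.trans (g := fun r => p r - p t) ?_
      hp.hasFDerivWithinAt.isBigO_sub
    refine Asymptotics.IsBigO.of_bound (1 / k) ?_
    filter_upwards [self_mem_nhdsWithin] with r hr
    have := hlip r hr
    rw [div_mul_eq_mul_div, one_mul, le_div_iff₀ hk]
    linarith
  have hxt : Tendsto x (𝓝[s] t) (𝓝 (x t)) := by
    rw [tendsto_iff_norm_sub_tendsto_zero, ← tendsto_zero_iff_norm_tendsto_zero]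
    refine hO.trans_tendsto ?_
    have : Tendsto (fun r : ℝ => r - t) (𝓝 t) (𝓝 (t - t)) := tendsto_id.sub_const t
    rw [sub_self] at this
    exact this.mono_left nhdsWithin_le_nhds
  have h1 := (hG.isLittleO.comp_tendsto hxt).trans_isBigO hO
  have h2 := hasDerivWithinAt_iff_isLittleO.1 hp
  refine Asymptotics.IsBigO.trans_isLittleO ?_ (h1.add h2)
  refine Asymptotics.IsBigO.of_bound (1 / k) ?_
  filter_upwards [self_mem_nhdsWithin] with r hr
  have h3 := hA (x r - x t - (r - t) • v)
  have e : A (x r - x t - (r - t) • v) = -((G (x r) - G (x t) - A (x r - x t)) +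
      (p r - p t - (r - t) • g)) := by
    rw [map_sub, map_smul, hv, hGx r hr, hGx t ht]
    module
  rw [e, norm_neg] at h3
  rw [div_mul_eq_mul_div, one_mul, le_div_iff₀ hk]
  simp only [Function.comp]
  linarith

theorem antitoneOn_Ici_of_hasDerivWithinAt_nonpos {V V' : ℝ → ℝ}
    (hV : ∀ t, 0 ≤ t → HasDerivWithinAt V (V' t) (Set.Ici 0) t) (h : ∀ t, 0 ≤ t → V' t ≤ 0) :
    AntitoneOn V (Set.Ici 0) := by
  have hd : ∀ t ∈ interior (Set.Ici (0 : ℝ)), HasDerivAt V (V' t) t := by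
    intro t ht
    rw [interior_Ici] at ht
    exact (hV t ht.le).hasDerivAt (Ici_mem_nhds ht)
  refine antitoneOn_of_deriv_nonpos (convex_Ici 0) (fun t ht => (hV t ht).continuousWithinAt)
    (fun t ht => (hd t ht).differentiableAt.differentiableWithinAt) fun t ht => ?_
  rw [(hd t ht).deriv]
  exact h t (interior_subset ht)

/-- If an energy dissipates at least at the rate `k ‖x'‖²`, the displacement of `x` is controlled
by the dissipated energy. -/
theorem norm_sub_le_of_dissipation {x v : ℝ → E} {V V' : ℝ → ℝ} {k : ℝ} (hk : 0 < k)
    (hx : ∀ t, 0 ≤ t → HasDerivWithinAt x (v t) (Set.Ici 0) t)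
    (hV : ∀ t, 0 ≤ t → HasDerivWithinAt V (V' t) (Set.Ici 0) t)
    (hV' : ∀ t, 0 ≤ t → V' t ≤ -(k * ‖v t‖ ^ 2)) {ε t s : ℝ} (hε : 0 < ε) (ht : 0 ≤ t)
    (hts : t ≤ s) : ‖x s - x t‖ ≤ ε * (s - t) + (V t - V s) / (k * ε) := by
  refine image_norm_le_of_norm_deriv_right_le_deriv_boundary' (a := t) (b := s)
    (f := fun r => x r - x t) (f' := v) (B := fun r => ε * (r - t) + (V t - V r) / (k * ε))
    (B' := fun r => ε + (-V' r) / (k * ε)) ?_ ?_ ?_ ?_ ?_ ?_ ⟨hts, le_rfl⟩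
  · intro r hr
    exact (((hx r (ht.trans hr.1)).continuousWithinAt).mono
      fun u hu => ht.trans hu.1).sub continuousWithinAt_const
  · intro r hr
    exact ((hx r (ht.trans hr.1)).mono fun u hu => (ht.trans hr.1).trans hu).sub_const _
  · simp
  · intro r hr
    have := ((hV r (ht.trans hr.1)).continuousWithinAt).mono
      (show Set.Icc t s ⊆ Set.Ici 0 from fun u hu => ht.trans hu.1)
    exact (by fun_prop : ContinuousWithinAt (fun r => ε * (r - t)) (Set.Icc t s) r).add
      ((continuousWithinAt_const.sub this).div_const _)
  · intro r hr
    have h1 := (hV r (ht.trans hr.1)).mono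
      (show Set.Ici r ⊆ Set.Ici 0 from fun u hu => (ht.trans hr.1).trans hu)
    have h2 : HasDerivWithinAt (fun r => ε * (r - t)) ε (Set.Ici r) r := by
      simpa using (((hasDerivAt_id r).sub_const t).const_mul ε).hasDerivWithinAt
    exact h2.add ((h1.const_sub (V t)).div_const _)
  · intro r hr
    have h := hV' r (ht.trans hr.1)
    have h1 : ‖v r‖ ^ 2 / ε ≤ -V' r / (k * ε) := by
      rw [div_le_div_iff₀ hε (by positivity)]
      nlinarith
    have h2 : ‖v r‖ ≤ ε + ‖v r‖ ^ 2 / ε := by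
      have : ε * ‖v r‖ ≤ ε * ε + ‖v r‖ ^ 2 := by nlinarith [sq_nonneg (ε - ‖v r‖), norm_nonneg (v r)]
      have h3 : ε + ‖v r‖ ^ 2 / ε = (ε * ε + ‖v r‖ ^ 2) / ε := by field_simp
      rw [h3, le_div_iff₀ hε]
      linarith
    linarith

/-- A dissipated energy dominated by `⟪p', x - z⟫` tends to zero if the increments of `p` are
controlled by those of `x`. -/
theorem tendsto_zero_of_dissipation {x v p g : ℝ → E} {V V' : ℝ → ℝ} {k M R : ℝ} {z : E}
    (hk : 0 < k) (hp : ∀ t, 0 ≤ t → HasDerivAt p (g t) t)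
    (hx : ∀ t, 0 ≤ t → HasDerivWithinAt x (v t) (Set.Ici 0) t)
    (hV : ∀ t, 0 ≤ t → HasDerivWithinAt V (V' t) (Set.Ici 0) t)
    (hV' : ∀ t, 0 ≤ t → V' t ≤ -(k * ‖v t‖ ^ 2)) (hV0 : ∀ t, 0 ≤ t → 0 ≤ V t)
    (hg : ∀ t, 0 ≤ t → ‖g t‖ ≤ M) (hVg : ∀ t, 0 ≤ t → V t ≤ ⟪g t, x t - z⟫)
    (hR : ∀ t, 0 ≤ t → ‖x t - z‖ ≤ R)
    (hpx : ∀ ε > 0, ∃ δ > 0, ∀ s t, 0 ≤ s → 0 ≤ t → ‖x s - x t‖ < δ → ‖p s - p t‖ < ε) :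
    Tendsto V atTop (𝓝 0) := by
  have hanti : AntitoneOn V (Set.Ici 0) := antitoneOn_Ici_of_hasDerivWithinAt_nonpos hV
    fun t ht => (hV' t ht).trans (neg_nonpos.2 (by positivity))
  have hR0 : 0 ≤ R := (norm_nonneg _).trans (hR 0 le_rfl)
  have hM0 : 0 ≤ M := (norm_nonneg _).trans (hg 0 le_rfl)
  set W : ℝ → ℝ := fun t => V (max t 0) with hW
  have hWanti : Antitone W := fun s t hst =>
    hanti (Set.mem_Ici.2 (le_max_right _ _)) (Set.mem_Ici.2 (le_max_right _ _))
      (max_le_max_right 0 hst)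
  have hWbdd : BddBelow (Set.range W) := ⟨0, by
    rintro _ ⟨t, rfl⟩
    exact hV0 _ (le_max_right _ _)⟩
  obtain ⟨L, hWL⟩ : ∃ L, Tendsto W atTop (𝓝 L) := ⟨_, tendsto_atTop_ciInf hWanti hWbdd⟩
  have hVL : Tendsto V atTop (𝓝 L) := hWL.congr' (by
    filter_upwards [eventually_ge_atTop 0] with t ht
    simp [hW, ht])
  have hLV : ∀ t, 0 ≤ t → L ≤ V t := fun t ht => by
    have := hWanti.le_of_tendsto hWL t
    simpa [hW, ht] using this
  have hL0 : 0 ≤ L := ge_of_tendsto hVL (by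
    filter_upwards [eventually_ge_atTop 0] with t ht using hV0 t ht)
  suffices hL : L ≤ 0 by rwa [le_antisymm hL hL0] at hVL
  have hdisp : ∀ δ > 0, ∀ᶠ t in atTop, ∀ s ∈ Set.Icc t (t + 1), ‖x s - x t‖ < δ := by
    intro δ hδ
    have hlim : ∀ᶠ t in atTop, V t < L + k * (δ / 2) * (δ / 2) :=
      hVL.eventually_lt_const (by have : 0 < k * (δ / 2) * (δ / 2) := by positivity
                                  linarith)
    filter_upwards [hlim, eventually_ge_atTop 0] with t ht ht0 s hs
    have h := norm_sub_le_of_dissipation hk hx hV hV' (half_pos hδ) ht0 hs.1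
    have h1 : (V t - V s) / (k * (δ / 2)) < δ / 2 := by
      rw [div_lt_iff₀ (by positivity)]
      linarith [hLV s (ht0.trans hs.1)]
    have h2 : δ / 2 * (s - t) ≤ δ / 2 := by nlinarith [hs.2]
    linarith
  refine le_of_forall_pos_le_add fun ε hε => ?_
  rw [zero_add]
  obtain ⟨δ, hδ, hpδ⟩ := hpx (ε / (2 * (R + 1))) (by positivity)
  have hη : 0 < ε / (2 * (M + 1)) := by positivity
  obtain ⟨t, hxδ, hxη, ht⟩ := ((hdisp δ hδ).and ((hdisp _ hη).and
    (eventually_ge_atTop (0 : ℝ)))).exists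
  have hd : ∀ s, 0 ≤ s → HasDerivAt (fun s => ⟪p s, x t - z⟫) ⟪g s, x t - z⟫ s := by
    intro s hs
    simpa using (hp s hs).inner ℝ (hasDerivAt_const s (x t - z))
  obtain ⟨s, hs, hslope⟩ := exists_hasDerivAt_eq_slope (fun s => ⟪p s, x t - z⟫)
    (fun s => ⟪g s, x t - z⟫) (lt_add_one t)
    (fun s hs => (hd s (ht.trans hs.1)).continuousAt.continuousWithinAt)
    (fun s hs => hd s (ht.trans hs.1.le))
  have hs0 : 0 ≤ s := ht.trans hs.1.le
  rw [add_sub_cancel_left, div_one, ← inner_sub_left] at hslope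
  have h1 : ⟪p (t + 1) - p t, x t - z⟫ ≤ ε / 2 := by
    refine (real_inner_le_norm _ _).trans ?_
    have ha := (hpδ (t + 1) t (by linarith) ht (hxδ _ ⟨by linarith, le_rfl⟩)).le
    calc ‖p (t + 1) - p t‖ * ‖x t - z‖ ≤ ε / (2 * (R + 1)) * R := by
          gcongr
          exact hR t ht
      _ ≤ ε / (2 * (R + 1)) * (R + 1) := by gcongr; linarith
      _ = ε / 2 := by field_simp
  have h2 : ⟪g s, x s - x t⟫ ≤ ε / 2 := by
    refine (real_inner_le_norm _ _).trans ?_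
    have ha := (hxη s (Set.Ioo_subset_Icc_self hs)).le
    calc ‖g s‖ * ‖x s - x t‖ ≤ M * (ε / (2 * (M + 1))) := by
          gcongr
          exact hg s hs0
      _ ≤ (M + 1) * (ε / (2 * (M + 1))) := by gcongr; linarith
      _ = ε / 2 := by field_simp
  have h3 : ⟪g s, x s - z⟫ = ⟪g s, x t - z⟫ + ⟪g s, x s - x t⟫ := by
    rw [← inner_add_right]
    congr 1
    abel
  linarith [hLV s hs0, hVg s hs0]

/-- Gradients of a convex function are bounded on compact subsets of an open subset of its
domain of boundedness. -/
theorem ConvexOn.exists_norm_gradient_le [CompleteSpace E] {s o K : Set E} {f : E → ℝ}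
    {g : E → E} (hf : ConvexOn ℝ s f) (hs : IsCompact s) (hfc : ContinuousOn f s)
    (ho : IsOpen o) (hos : o ⊆ s) (hK : IsCompact K) (hKo : K ⊆ o)
    (hg : ∀ x ∈ K, HasGradientAt f (g x) x) : ∃ M, ∀ x ∈ K, ‖g x‖ ≤ M := by
  obtain ⟨r, hr, hrK⟩ := hK.exists_cthickening_subset_open ho hKo
  obtain ⟨C, hC⟩ := hs.exists_bound_of_continuousOn hfc
  refine ⟨2 * C / r, fun x hx => ?_⟩
  have hxs := hos (hKo hx)
  rw [le_div_iff₀ hr]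
  rcases eq_or_ne (g x) 0 with h0 | h0
  · rw [h0, norm_zero, zero_mul]
    linarith [(norm_nonneg _).trans (hC x hxs)]
  have hn : 0 < ‖g x‖ := norm_pos_iff.2 h0
  have hy : x + (r / ‖g x‖) • g x ∈ s := by
    refine hos (hrK (Metric.mem_cthickening_of_dist_le _ x r K hx ?_))
    rw [dist_eq_norm, add_sub_cancel_left, norm_smul, Real.norm_of_nonneg (by positivity),
      div_mul_cancel₀ _ hn.ne']
  have h1 := hf.inner_gradient_le_sub hxs hy (hg x hx)
  rw [add_sub_cancel_left, inner_smul_right, real_inner_self_eq_norm_sq] at h1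
  have e : r / ‖g x‖ * ‖g x‖ ^ 2 = ‖g x‖ * r := by field_simp
  rw [e] at h1
  have h2 := abs_le.1 (hC x hxs)
  have h3 := abs_le.1 (hC _ hy)
  linarith

/-- Quadratic growth of a strongly convex function away from a minimizer. -/
theorem StrongConvexOn.quadratic_growth {s : Set E} {f : E → ℝ} {μ : ℝ}
    (hf : StrongConvexOn s μ f) {x z : E} (hx : x ∈ s) (hz : z ∈ s)
    (hmin : ∀ y ∈ s, f z ≤ f y) : μ / 4 * ‖x - z‖ ^ 2 ≤ f x - f z := by
  obtain ⟨hconv, hineq⟩ := hf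
  have h := hineq hx hz one_half_pos.le one_half_pos.le (add_halves (1 : ℝ))
  have h1 := hmin _ (hconv hx hz one_half_pos.le one_half_pos.le (add_halves (1 : ℝ)))
  simp only [smul_eq_mul] at h
  linarith

end Helpers

theorem inner_symCLM_apply {n : ℕ}
    (T : EuclideanSpace ℝ (Fin n) →L[ℝ] EuclideanSpace ℝ (Fin n)) (w : EuclideanSpace ℝ (Fin n)) :
    ⟪w, symCLM T w⟫ = ⟪T w, w⟫ := by
  simp only [symCLM, smul_add, add_apply, smul_apply,
    inner_add_right, inner_smul_right, ContinuousLinearMap.adjoint_inner_right]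
  rw [real_inner_comm w (T w)]
  ring

theorem stmt11 {n : ℕ} (a b : Fin n → ℝ) (hab : ∀ i, a i < b i)
    (𝒳 : Set (EuclideanSpace ℝ (Fin n)))
    (h𝒳 : 𝒳 = {x : EuclideanSpace ℝ (Fin n) | ∀ i, x i ∈ Set.Icc (a i) (b i)})
    (G₀ : EuclideanSpace ℝ (Fin n) → EuclideanSpace ℝ (Fin n))
    (DG₀ : EuclideanSpace ℝ (Fin n) →
      EuclideanSpace ℝ (Fin n) →L[ℝ] EuclideanSpace ℝ (Fin n))
    (U : Set (EuclideanSpace ℝ (Fin n))) (hU : IsOpen U) (hXU : 𝒳 ⊆ U)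
    (hG₀ : ∀ x ∈ U, HasFDerivAt G₀ (DG₀ x) x)
    (m : ℝ) (hm : 0 < m)
    (hsym : ∀ x ∈ 𝒳, ∀ w, ⟪w, symCLM (DG₀ x) w⟫ ≥ m / 2 * ‖w‖ ^ 2)
    -- `x*` is the response map: the inverse of `x ↦ −G₀(x)` from `int 𝒳` onto `𝒫`
    (xstar : EuclideanSpace ℝ (Fin n) → EuclideanSpace ℝ (Fin n))
    (hmaps : Set.MapsTo xstar ((fun x => -G₀ x) '' interior 𝒳) (interior 𝒳))
    (hinv₁ : ∀ p ∈ (fun x => -G₀ x) '' interior 𝒳, G₀ (xstar p) = -p)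
    (hinv₂ : ∀ x ∈ interior 𝒳, xstar (-G₀ x) = x)
    -- the planner's social cost `Φ`
    (Φ : EuclideanSpace ℝ (Fin n) → ℝ)
    (gradΦ : EuclideanSpace ℝ (Fin n) → EuclideanSpace ℝ (Fin n))
    (hΦ : ∀ x, HasGradientAt Φ (gradΦ x) x)
    (μΦ : ℝ) (hμΦ : 0 < μΦ) (hΦconv : StrongConvexOn 𝒳 μΦ Φ)
    (xdag : EuclideanSpace ℝ (Fin n)) (hxdag : xdag ∈ interior 𝒳)
    (hmin : ∀ x ∈ 𝒳, Φ xdag ≤ Φ x)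
    -- the sublevel set `𝒫_c` with `0 ≤ c < c*`
    (c : ℝ) (hc0 : 0 ≤ c) (hcstar : c < sInf ((fun x => Φ x - Φ xdag) '' frontier 𝒳))
    -- a `C¹` solution `p : [0,∞) → 𝒫` of the social-gradient flow starting in `𝒫_c`
    (p : ℝ → EuclideanSpace ℝ (Fin n))
    (hpdom : ∀ t : ℝ, 0 ≤ t → p t ∈ (fun x => -G₀ x) '' interior 𝒳)
    (hode : ∀ t : ℝ, 0 ≤ t → HasDerivAt p (gradΦ (xstar (p t))) t)
    (hp0 : Φ (xstar (p 0)) - Φ xdag ≤ c) :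
    -- forward invariance of `𝒫_c`
    (∀ t : ℝ, 0 ≤ t → Φ (xstar (p t)) - Φ xdag ≤ c) ∧
    -- `p† = −G₀(x†)` is the unique equilibrium of the flow in `𝒫_c`
    (-G₀ xdag ∈ {q ∈ (fun x => -G₀ x) '' interior 𝒳 | Φ (xstar q) - Φ xdag ≤ c}) ∧
    (∀ q ∈ {q ∈ (fun x => -G₀ x) '' interior 𝒳 | Φ (xstar q) - Φ xdag ≤ c},
      (gradΦ (xstar q) = 0 ↔ q = -G₀ xdag)) ∧
    -- convergence of the solution to `p†`
    Tendsto p atTop (𝓝 (-G₀ xdag)) := by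
  have hXc : Convex ℝ 𝒳 := hΦconv.1
  have hXcpt : IsCompact 𝒳 := by
    have e : 𝒳 = (EuclideanSpace.equiv (Fin n) ℝ).toHomeomorph ⁻¹'
        Set.pi Set.univ fun i => Set.Icc (a i) (b i) := by
      rw [h𝒳]
      ext x
      simp only [Set.mem_ofPred_eq, Set.mem_preimage, Set.mem_pi, Set.mem_univ, true_imp_iff]
      rfl
    rw [e, Homeomorph.isCompact_preimage]
    exact isCompact_univ_pi fun i => isCompact_Icc
  have hint : interior 𝒳 ⊆ 𝒳 := interior_subset
  have hGX : ∀ x ∈ 𝒳, HasFDerivAt G₀ (DG₀ x) x := fun x hx => hG₀ x (hXU hx)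
  have hcoer : ∀ x ∈ 𝒳, ∀ w, m / 2 * ‖w‖ ^ 2 ≤ ⟪DG₀ x w, w⟫ := fun x hx w => by
    rw [← inner_symCLM_apply]
    exact hsym x hx w
  have hm2 : 0 < m / 2 := half_pos hm
  have hgrad : ∀ x ∈ 𝒳, ∀ y ∈ 𝒳, ⟪gradΦ x, y - x⟫ ≤ Φ y - Φ x := fun x hx y hy =>
    (hΦconv.strictConvexOn hμΦ).convexOn.inner_gradient_le_sub hx hy (hΦ x)
  have hgrow : ∀ x ∈ 𝒳, μΦ / 4 * ‖x - xdag‖ ^ 2 ≤ Φ x - Φ xdag := fun x hx =>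
    hΦconv.quadratic_growth hx (hint hxdag) hmin
  have hΦcont : Continuous Φ := continuous_iff_continuousAt.2 fun x => (hΦ x).continuousAt
  have hGcont : ContinuousOn G₀ 𝒳 := fun x hx => (hGX x hx).continuousAt.continuousWithinAt
  have hgdag : gradΦ xdag = 0 := by
    have hloc : IsLocalMin Φ xdag := by
      filter_upwards [mem_interior_iff_mem_nhds.1 hxdag] with y hy using hmin y hy
    simpa using hloc.hasFDerivAt_eq_zero (hΦ xdag).hasFDerivAt
  have hxX : ∀ t : ℝ, 0 ≤ t → xstar (p t) ∈ 𝒳 := fun t ht => hint (hmaps (hpdom t ht))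
  have hGx : ∀ t : ℝ, 0 ≤ t → G₀ (xstar (p t)) = -p t := fun t ht => hinv₁ _ (hpdom t ht)
  have hbelow : ∀ x ∈ 𝒳, ∀ w, m / 2 * ‖w‖ ≤ ‖DG₀ x w‖ := fun x hx w =>
    mul_norm_le_of_mul_sq_le_inner (hcoer x hx w)
  have hsurj : ∀ x ∈ 𝒳, Function.Surjective (DG₀ x) := fun x hx => by
    refine (LinearMap.injective_iff_surjective (f := (DG₀ x).toLinearMap)).1 ?_
    refine (injective_iff_map_eq_zero _).2 fun w hw => ?_
    have h := hbelow x hx w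
    rw [show DG₀ x w = 0 from hw, norm_zero] at h
    exact norm_le_zero_iff.1 (by nlinarith)
  have hv : ∀ t : ℝ, ∃ w, 0 ≤ t → DG₀ (xstar (p t)) w = -gradΦ (xstar (p t)) := fun t => by
    by_cases ht : 0 ≤ t
    · obtain ⟨w, hw⟩ := hsurj _ (hxX t ht) (-gradΦ (xstar (p t)))
      exact ⟨w, fun _ => hw⟩
    · exact ⟨0, fun h => absurd h ht⟩
  choose v hv using hv
  have hx' : ∀ t : ℝ, 0 ≤ t →
      HasDerivWithinAt (fun t => xstar (p t)) (v t) (Set.Ici 0) t := fun t ht => by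
    refine hasDerivWithinAt_of_comp_neg hm2 (hGX _ (hxX t ht)) (hbelow _ (hxX t ht))
      (hode t ht).hasDerivWithinAt (hv t ht) ht (fun r hr => hGx r hr) fun r hr => ?_
    have h := mul_norm_le_of_mul_sq_le_inner
      (hXc.strongly_monotone_of_coercive_fderiv hGX hcoer (hxX t ht) (hxX r hr))
    rwa [hGx r hr, hGx t ht, ← neg_sub', norm_neg] at h
  have hV : ∀ t : ℝ, 0 ≤ t → HasDerivWithinAt (fun t => Φ (xstar (p t)) - Φ xdag)
      ⟪gradΦ (xstar (p t)), v t⟫ (Set.Ici 0) t := fun t ht => by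
    have h := (hΦ (xstar (p t))).hasFDerivAt.comp_hasDerivWithinAt t (hx' t ht)
    simpa using h.sub_const (Φ xdag)
  have hV' : ∀ t : ℝ, 0 ≤ t → ⟪gradΦ (xstar (p t)), v t⟫ ≤ -(m / 2 * ‖v t‖ ^ 2) :=
    fun t ht => by
      have h := hcoer _ (hxX t ht) (v t)
      rw [hv t ht, inner_neg_left] at h
      linarith
  have hV0 : ∀ t : ℝ, 0 ≤ t → 0 ≤ Φ (xstar (p t)) - Φ xdag := fun t ht =>
    sub_nonneg.2 (hmin _ (hxX t ht))
  have hinvariant : ∀ t : ℝ, 0 ≤ t → Φ (xstar (p t)) - Φ xdag ≤ c := fun t ht =>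
    (antitoneOn_Ici_of_hasDerivWithinAt_nonpos hV (fun t ht => (hV' t ht).trans
      (neg_nonpos.2 (by positivity))) (le_refl (0 : ℝ)) ht ht).trans hp0
  refine ⟨hinvariant, ⟨⟨xdag, hxdag, rfl⟩, ?_⟩, ?_, ?_⟩
  · rw [hinv₂ _ hxdag, sub_self]
    exact hc0
  · rintro _ ⟨⟨x, hx, rfl⟩, -⟩
    change gradΦ (xstar (-G₀ x)) = 0 ↔ -G₀ x = -G₀ xdag
    rw [hinv₂ x hx]
    constructor
    · intro h0
      have h1 := hgrad x (hint hx) xdag (hint hxdag)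
      have h2 := hgrow x (hint hx)
      rw [h0, inner_zero_left] at h1
      have h3 : ‖x - xdag‖ ^ 2 = 0 := le_antisymm (by nlinarith) (by positivity)
      rw [sub_eq_zero.1 (norm_eq_zero.1 (pow_eq_zero_iff two_ne_zero |>.1 h3))]
    · intro h
      rw [← hinv₂ x hx, h, hinv₂ _ hxdag, hgdag]
  set K : Set (EuclideanSpace ℝ (Fin n)) := {x ∈ 𝒳 | Φ x - Φ xdag ≤ c} with hKdef
  have hK : IsCompact K := hXcpt.inter_right
    (isClosed_le (hΦcont.sub continuous_const) continuous_const)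
  have hKo : K ⊆ interior 𝒳 := fun x hx => by
    by_contra hxi
    have hfr : x ∈ frontier 𝒳 := by
      rw [hXcpt.isClosed.frontier_eq]
      exact ⟨hx.1, hxi⟩
    have hbdd : BddBelow ((fun x => Φ x - Φ xdag) '' frontier 𝒳) := ⟨0, by
      rintro _ ⟨y, hy, rfl⟩
      exact sub_nonneg.2 (hmin y (hXcpt.isClosed.frontier_subset hy))⟩
    linarith [csInf_le hbdd ⟨x, hfr, rfl⟩, hx.2]
  obtain ⟨M, hM⟩ := (hΦconv.strictConvexOn hμΦ).convexOn.exists_norm_gradient_le hXcpt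
    hΦcont.continuousOn isOpen_interior hint hK hKo fun x _ => hΦ x
  obtain ⟨R, hR⟩ := hXcpt.exists_bound_of_continuousOn
    (f := fun x => x - xdag) (by fun_prop)
  have hlim : Tendsto (fun t => Φ (xstar (p t)) - Φ xdag) atTop (𝓝 0) := by
    refine tendsto_zero_of_dissipation (z := xdag) (M := M) (R := R) hm2 hode hx' hV hV' hV0
      (fun t ht => hM _ ⟨hxX t ht, hinvariant t ht⟩) (fun t ht => ?_)
      (fun t ht => hR _ (hxX t ht)) fun ε hε => ?_
    · have h := hgrad _ (hxX t ht) xdag (hint hxdag)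
      rw [← neg_sub, inner_neg_right] at h
      linarith
    · obtain ⟨δ, hδ, h⟩ := Metric.uniformContinuousOn_iff.1
        (hXcpt.uniformContinuousOn_of_continuous hGcont) ε hε
      refine ⟨δ, hδ, fun s t hs ht hst => ?_⟩
      have h1 := h _ (hxX s hs) _ (hxX t ht) (by rwa [dist_eq_norm])
      rwa [hGx s hs, hGx t ht, dist_neg_neg, dist_eq_norm] at h1
  have hxlim : Tendsto (fun t => xstar (p t)) atTop (𝓝 xdag) := by
    rw [tendsto_iff_norm_sub_tendsto_zero]
    have hsq : Tendsto (fun t => ‖xstar (p t) - xdag‖ ^ 2) atTop (𝓝 0) := by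
      refine squeeze_zero' (Eventually.of_forall fun t => by positivity) ?_
        (by simpa using hlim.const_mul (4 / μΦ))
      filter_upwards [eventually_ge_atTop 0] with t ht
      have h := hgrow _ (hxX t ht)
      rw [div_mul_eq_mul_div, le_div_iff₀ hμΦ]
      linarith
    simpa using hsq.sqrt
  have hGlim := ((hGX xdag (hint hxdag)).continuousAt.tendsto.comp hxlim).neg
  refine hGlim.congr' ?_
  filter_upwards [eventually_ge_atTop 0] with t ht
  simp [hGx t ht]
end

section
/- Let P_c ⊂ ℝⁿ be a compact (possibly nonconvex) set contained in an open set U ⊆ ℝⁿ, and let g : U → ℝⁿ be L_g-Lipschitz. Suppose P_c is forward invariant for the ODE ṗ = g(p); suppose p† ∈ int(P_c) is the unique zero of g in P_c, p† is Lyapunov stable for the ODE, and every solution of ṗ = g(p) with initial condition in U converges to p† as t → ∞. Let (p_k)_{k≥0} ⊂ P_c satisfy p_{k+1} = p_k + a_k g(p_k), where a_k > 0, Σ_k a_k = ∞ and Σ_k a_k² < ∞. Then lim_{k→∞} p_k = p†. -/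
open Filter Topology

section GlobalSolutions

variable {E : Type*} [NormedAddCommGroup E] [NormedSpace ℝ E]

/-- A bounded Lipschitz autonomous vector field has a global integral curve through each point. -/
theorem exists_global_solution_of_lipschitz_of_bounded [CompleteSpace E] {F : E → E}
    {K M : NNReal} (hF : LipschitzWith K F) (hM : ∀ x, ‖F x‖ ≤ M) (y : E) :
    ∃ q : ℝ → E, q 0 = y ∧ ∀ t, HasDerivAt q (F (q t)) t := by
  have hloc : ∀ N : ℕ, ∃ α : ℝ → E, α 0 = y ∧
      ∀ t ∈ Set.Ioo (-(N + 1) : ℝ) (N + 1), HasDerivAt α (F (α t)) t := by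
    intro N
    have h0 : (0 : ℝ) ∈ Set.Icc (-(N + 1) : ℝ) (N + 1) := by
      constructor <;> linarith [Nat.cast_nonneg (α := ℝ) N]
    have hpl : IsPicardLindelof (fun _ : ℝ => F) (⟨0, h0⟩ : Set.Icc (-(N + 1) : ℝ) (N + 1)) y
        (M * (N + 1)) 0 M K :=
      { lipschitzOnWith := fun _ _ => hF.lipschitzOnWith
        continuousOn := fun _ _ => continuousOn_const
        norm_le := fun _ _ x _ => hM x
        mul_max_le := by simp }
    obtain ⟨α, h1, h2⟩ := hpl.exists_eq_forall_mem_Icc_hasDerivWithinAt₀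
    exact ⟨α, h1, fun t ht =>
      (h2 t (Set.Ioo_subset_Icc_self ht)).hasDerivAt (Icc_mem_nhds ht.1 ht.2)⟩
  choose α hα0 hα using hloc
  have hmono : ∀ m n : ℕ, m ≤ n → Set.EqOn (α m) (α n) (Set.Ioo (-(m + 1) : ℝ) (m + 1)) := by
    intro m n hmn
    have hmn' : (m : ℝ) ≤ n := by exact_mod_cast hmn
    have hm : (0 : ℝ) ≤ m := Nat.cast_nonneg m
    refine ODE_solution_unique_of_mem_Ioo (v := fun _ => F) (s := fun _ => Set.univ)
      (t₀ := 0) (K := K) (fun _ _ => hF.lipschitzOnWith) ⟨by linarith, by linarith⟩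
      (fun t ht => ⟨hα m t ht, trivial⟩) (fun t ht => ⟨hα n t ⟨?_, ?_⟩, trivial⟩) ?_
    · linarith [ht.1]
    · linarith [ht.2]
    · rw [hα0, hα0]
  have heq : ∀ N : ℕ, ∀ t ∈ Set.Ioo (-(N + 1) : ℝ) (N + 1), α ⌈|t|⌉₊ t = α N t := by
    intro N t ht
    have hceil : ⌈|t|⌉₊ ≤ N + 1 := Nat.ceil_le.2 (by push_cast; exact (abs_lt.2 ht).le)
    have ht' : t ∈ Set.Ioo (-(⌈|t|⌉₊ + 1) : ℝ) (⌈|t|⌉₊ + 1) :=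
      abs_lt.1 (by linarith [Nat.le_ceil |t|])
    rw [hmono _ _ hceil ht', hmono _ _ (Nat.le_succ N) ht]
  refine ⟨fun t => α ⌈|t|⌉₊ t, by simp [hα0], fun t => ?_⟩
  obtain ⟨N, hN⟩ := exists_nat_gt |t|
  have ht : t ∈ Set.Ioo (-(N + 1) : ℝ) (N + 1) := abs_lt.1 (by linarith)
  have hev : (fun t => α ⌈|t|⌉₊ t) =ᶠ[𝓝 t] α N :=
    Filter.eventuallyEq_of_mem (Ioo_mem_nhds ht.1 ht.2) (heq N)
  have := (hα N t ht).congr_of_eventuallyEq hev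
  simpa [heq N t ht] using this

end GlobalSolutions

section BoundedExtension

/-- A bounded Lipschitz map on a set extends to a bounded Lipschitz map on the whole space. -/
theorem exists_bounded_lipschitz_extension {α : Type*} [PseudoMetricSpace α] {n : ℕ} {s : Set α}
    {f : α → EuclideanSpace ℝ (Fin n)} {K : NNReal} (hf : LipschitzOnWith K f s) {M : ℝ}
    (hM : ∀ x ∈ s, ‖f x‖ ≤ M) :
    ∃ (K' M' : NNReal) (F : α → EuclideanSpace ℝ (Fin n)),
      LipschitzWith K' F ∧ (∀ x, ‖F x‖ ≤ M') ∧ Set.EqOn F f s := by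
  obtain ⟨G, hG, hGs⟩ := hf.extend_finite_dimension
  set B : ℝ := |M|
  have hB0 : 0 ≤ B := abs_nonneg M
  let c : ℝ → ℝ := fun r => max (-B) (min B r)
  have hc : LipschitzWith 1 c := (LipschitzWith.id.const_min B).const_max (-B)
  have hcb : ∀ r, |c r| ≤ B := fun r =>
    abs_le.2 ⟨le_max_left _ _, max_le (by linarith) (min_le_left _ _)⟩
  have hcid : ∀ r, |r| ≤ B → c r = r := fun r hr => by
    have := abs_le.1 hr
    simp only [c]
    rw [min_eq_right this.2, max_eq_right this.1]
  have hpi : LipschitzWith 1 (fun v : Fin n → ℝ => fun i => c (v i)) :=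
    LipschitzWith.of_dist_le_mul fun v w => by
      rw [NNReal.coe_one, one_mul]
      exact (dist_pi_le_iff dist_nonneg).2 fun i =>
        (hc.dist_le_mul _ _).trans (by simpa using dist_le_pi_dist v w i)
  obtain ⟨L, hto⟩ : ∃ L, LipschitzWith L (WithLp.toLp 2 : (Fin n → ℝ) → EuclideanSpace ℝ (Fin n)) :=
    ⟨_, PiLp.lipschitzWith_toLp 2 (fun _ : Fin n => ℝ)⟩
  have hof := PiLp.lipschitzWith_ofLp 2 (fun _ : Fin n => ℝ)
  refine ⟨_, L * B.toNNReal, fun x => WithLp.toLp 2 (fun i => c (G x i)),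
    hto.comp (hpi.comp (hof.comp hG)), fun x => ?_, fun x hx => ?_⟩
  · have h := hto.dist_le_mul (fun i => c (G x i)) 0
    rw [WithLp.toLp_zero, dist_zero_right] at h
    refine h.trans ?_
    rw [NNReal.coe_mul, Real.coe_toNNReal B hB0]
    refine mul_le_mul_of_nonneg_left ?_ (NNReal.coe_nonneg _)
    exact (dist_pi_le_iff hB0).2 fun i => by simpa using hcb _
  · ext i
    simp only
    rw [← hGs hx, hcid]
    exact ((PiLp.norm_apply_le (f x) i).trans (hM x hx)).trans (le_abs_self M)

end BoundedExtension

section Euler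

variable {E : Type*} [NormedAddCommGroup E] [NormedSpace ℝ E] {F : E → E} {K M : NNReal}
  {q : ℝ → E}

theorem norm_solution_sub_le (hM : ∀ x, ‖F x‖ ≤ M) (hq : ∀ t, HasDerivAt q (F (q t)) t)
    (s t : ℝ) : ‖q t - q s‖ ≤ M * |t - s| := by
  simpa using convex_univ.norm_image_sub_le_of_norm_hasDerivWithin_le
    (fun x _ => (hq x).hasDerivWithinAt) (fun x _ => hM (q x)) (Set.mem_univ s) (Set.mem_univ t)

/-- Local truncation error of the explicit Euler scheme. -/
theorem norm_euler_truncation_le (hF : LipschitzWith K F) (hM : ∀ x, ‖F x‖ ≤ M)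
    (hq : ∀ t, HasDerivAt q (F (q t)) t) (s : ℝ) {h : ℝ} (hh : 0 ≤ h) :
    ‖q (s + h) - q s - h • F (q s)‖ ≤ K * M * h ^ 2 := by
  have hd : ∀ x, HasDerivAt (fun r => q r - (r - s) • F (q s)) (F (q x) - F (q s)) x := by
    intro x
    simpa using (hq x).fun_sub (((hasDerivAt_id' x).sub_const s).smul_const (F (q s)))
  have hb : ∀ x ∈ Set.Icc s (s + h), ‖F (q x) - F (q s)‖ ≤ K * (M * h) := by
    intro x hx
    refine (hF.norm_sub_le _ _).trans (mul_le_mul_of_nonneg_left ?_ K.coe_nonneg)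
    refine (norm_solution_sub_le hM hq s x).trans (mul_le_mul_of_nonneg_left ?_ M.coe_nonneg)
    rw [abs_of_nonneg] <;> linarith [hx.1, hx.2]
  have := (convex_Icc s (s + h)).norm_image_sub_le_of_norm_hasDerivWithin_le
    (fun x _ => (hd x).hasDerivWithinAt) hb (Set.left_mem_Icc.2 (by linarith))
    (Set.right_mem_Icc.2 (by linarith))
  simp only [add_sub_cancel_left, sub_self, zero_smul, sub_zero, Real.norm_eq_abs,
    abs_of_nonneg hh] at this
  calc _ = ‖q (s + h) - h • F (q s) - q s‖ := by congr 1; abel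
    _ ≤ K * (M * h) * h := this
    _ = _ := by ring

variable {a : ℕ → ℝ} {p : ℕ → E}

/-- Accumulated error of the explicit Euler scheme with variable step sizes. -/
theorem norm_euler_sub_solution_le (hF : LipschitzWith K F) (hM : ∀ x, ‖F x‖ ≤ M)
    (hq : ∀ t, HasDerivAt q (F (q t)) t) (ha : ∀ k, 0 < a k)
    (hrec : ∀ k, p (k + 1) = p k + a k • F (p k)) {m i : ℕ} (hmi : m ≤ i) :
    ‖p i - q (∑ k ∈ Finset.range i, a k - ∑ k ∈ Finset.range m, a k)‖ ≤
      Real.exp (K * (∑ k ∈ Finset.range i, a k - ∑ k ∈ Finset.range m, a k)) *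
        (‖p m - q 0‖ + K * M *
          (∑ k ∈ Finset.range i, a k ^ 2 - ∑ k ∈ Finset.range m, a k ^ 2)) := by
  induction i, hmi using Nat.le_induction with
  | base => simp
  | succ i hmi ih =>
    rw [Finset.sum_range_succ, Finset.sum_range_succ]
    set τ := ∑ k ∈ Finset.range i, a k - ∑ k ∈ Finset.range m, a k with hτ
    set S := ∑ k ∈ Finset.range i, a k ^ 2 - ∑ k ∈ Finset.range m, a k ^ 2 with hS
    have e1 : ∑ k ∈ Finset.range i, a k + a i - ∑ k ∈ Finset.range m, a k = τ + a i := by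
      rw [hτ]; ring
    have e2 : ∑ k ∈ Finset.range i, a k ^ 2 + a i ^ 2 - ∑ k ∈ Finset.range m, a k ^ 2
        = S + a i ^ 2 := by rw [hS]; ring
    rw [e1, e2, hrec]
    have hai := (ha i).le
    have hτ0 : 0 ≤ τ := sub_nonneg.2 <|
      Finset.sum_le_sum_of_subset_of_nonneg (Finset.range_mono hmi) fun k _ _ => (ha k).le
    have htr := norm_euler_truncation_le hF hM hq τ hai
    have hstep : ‖p i + a i • F (p i) - q (τ + a i)‖ ≤
        (1 + K * a i) * ‖p i - q τ‖ + K * M * a i ^ 2 := by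
      have e : p i + a i • F (p i) - q (τ + a i) =
          (p i - q τ) + a i • (F (p i) - F (q τ)) - (q (τ + a i) - q τ - a i • F (q τ)) := by
        rw [smul_sub]; abel
      rw [e]
      refine (norm_sub_le _ _).trans <| add_le_add ((norm_add_le _ _).trans ?_) htr
      rw [norm_smul, Real.norm_of_nonneg hai]
      have := mul_le_mul_of_nonneg_left (hF.norm_sub_le (p i) (q τ)) hai
      linarith
    set A := ‖p m - q 0‖ + K * M * S with hA
    have hX0 : 0 ≤ K * M * a i ^ 2 := by positivity
    have hA0 : 0 ≤ Real.exp (K * τ) * A := (norm_nonneg _).trans ih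
    have hexp : 1 + K * a i ≤ Real.exp (K * a i) := by
      linarith [Real.add_one_le_exp (K * a i)]
    have hexp1 : 1 ≤ Real.exp (K * (τ + a i)) := Real.one_le_exp (by positivity)
    calc _ ≤ (1 + K * a i) * ‖p i - q τ‖ + K * M * a i ^ 2 := hstep
      _ ≤ Real.exp (K * a i) * (Real.exp (K * τ) * A)
          + Real.exp (K * (τ + a i)) * (K * M * a i ^ 2) := by
        refine add_le_add ?_ (le_mul_of_one_le_left hX0 hexp1)
        exact mul_le_mul hexp ih (norm_nonneg _) (Real.exp_pos _).le
      _ = _ := by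
        rw [hA, mul_add (K : ℝ) τ, Real.exp_add]; ring

/-- If Euler iterates along a subsequence converge to `q 0`, then over bounded time horizons the
tails of the iteration starting there are uniformly close to `q`. -/
theorem eventually_euler_shadows (hF : LipschitzWith K F) (hM : ∀ x, ‖F x‖ ≤ M)
    (hq : ∀ t, HasDerivAt q (F (q t)) t) (ha : ∀ k, 0 < a k)
    (hasq : Summable fun k => a k ^ 2)
    (hrec : ∀ k, p (k + 1) = p k + a k • F (p k)) {m : ℕ → ℕ} (hm : Tendsto m atTop atTop)
    (hpm : Tendsto (fun j => p (m j)) atTop (𝓝 (q 0))) (T : ℝ) {η : ℝ} (hη : 0 < η) :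
    ∀ᶠ j in atTop, ∀ i, m j ≤ i →
      ∑ k ∈ Finset.range i, a k - ∑ k ∈ Finset.range (m j), a k ≤ T →
      ‖p i - q (∑ k ∈ Finset.range i, a k - ∑ k ∈ Finset.range (m j), a k)‖ < η := by
  have hlim : Tendsto (fun j => Real.exp (K * T) * (‖p (m j) - q 0‖ + K * M *
      (∑' k, a k ^ 2 - ∑ k ∈ Finset.range (m j), a k ^ 2))) atTop (𝓝 0) := by
    have h1 : Tendsto (fun j => ‖p (m j) - q 0‖) atTop (𝓝 0) :=
      tendsto_iff_norm_sub_tendsto_zero.1 hpm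
    have h2 : Tendsto (fun j => ∑ k ∈ Finset.range (m j), a k ^ 2) atTop (𝓝 (∑' k, a k ^ 2)) :=
      hasq.hasSum.tendsto_sum_nat.comp hm
    have h3 := tendsto_const_nhds (x := ∑' k, a k ^ 2) |>.sub h2
    rw [sub_self] at h3
    simpa only [mul_zero, add_zero] using
      (h1.add (h3.const_mul (K * M : ℝ))).const_mul (Real.exp (K * T))
  filter_upwards [hlim.eventually_lt_const hη] with j hj i hi hT
  refine (norm_euler_sub_solution_le hF hM hq ha hrec hi).trans_lt (lt_of_le_of_lt ?_ hj)
  have hS : ∑ k ∈ Finset.range i, a k ^ 2 ≤ ∑' k, a k ^ 2 :=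
    hasq.sum_le_tsum _ fun k _ => sq_nonneg _
  have hS0 : ∑ k ∈ Finset.range (m j), a k ^ 2 ≤ ∑ k ∈ Finset.range i, a k ^ 2 :=
    Finset.sum_le_sum_of_subset_of_nonneg (Finset.range_mono hi) fun k _ _ => sq_nonneg _
  have : 0 ≤ ∑ k ∈ Finset.range i, a k ^ 2 - ∑ k ∈ Finset.range (m j), a k ^ 2 := by linarith
  gcongr

/-- Every time `τ ≥ 0` lies in a step of the partition starting at index `m`. -/
theorem exists_partition_step (hasum : Tendsto (fun N => ∑ k ∈ Finset.range N, a k) atTop atTop)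
    (m : ℕ) {τ : ℝ} (hτ : 0 ≤ τ) :
    ∃ i, m ≤ i ∧ ∑ k ∈ Finset.range i, a k - ∑ k ∈ Finset.range m, a k ≤ τ ∧
      τ < ∑ k ∈ Finset.range i, a k - ∑ k ∈ Finset.range m, a k + a i := by
  by_contra! hcon
  have hall : ∀ i, m ≤ i →
      ∑ k ∈ Finset.range i, a k - ∑ k ∈ Finset.range m, a k ≤ τ := by
    intro i hi
    induction i, hi using Nat.le_induction with
    | base => simpa using hτ
    | succ i hi ih =>
      rw [Finset.sum_range_succ]
      linarith [hcon i hi ih]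
  obtain ⟨i, hi, hmi⟩ := ((hasum.eventually_gt_atTop
    (τ + ∑ k ∈ Finset.range m, a k)).and (eventually_ge_atTop m)).exists
  linarith [hall i hmi]

/-- Pointwise form of the shadowing property: each point of the limiting trajectory is
approximated by iterates. -/
theorem eventually_exists_euler_near (hF : LipschitzWith K F) (hM : ∀ x, ‖F x‖ ≤ M)
    (hq : ∀ t, HasDerivAt q (F (q t)) t) (ha : ∀ k, 0 < a k)
    (hasum : Tendsto (fun N => ∑ k ∈ Finset.range N, a k) atTop atTop)
    (hasq : Summable fun k => a k ^ 2)
    (hrec : ∀ k, p (k + 1) = p k + a k • F (p k)) {m : ℕ → ℕ} (hm : Tendsto m atTop atTop)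
    (hpm : Tendsto (fun j => p (m j)) atTop (𝓝 (q 0))) {τ : ℝ} (hτ : 0 ≤ τ) {η : ℝ}
    (hη : 0 < η) :
    ∀ᶠ j in atTop, ∃ i, m j ≤ i ∧
      ∑ k ∈ Finset.range i, a k - ∑ k ∈ Finset.range (m j), a k ≤ τ ∧ ‖p i - q τ‖ < η := by
  have ha0 : Tendsto (fun k => M * a k) atTop (𝓝 0) := by
    have h := hasq.tendsto_atTop_zero.sqrt
    simp only [Real.sqrt_sq (ha _).le, Real.sqrt_zero] at h
    simpa using h.const_mul (M : ℝ)
  have hsmall : ∀ᶠ j in atTop, ∀ i, m j ≤ i → M * a i < η / 2 := by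
    obtain ⟨N, hN⟩ := eventually_atTop.1 (ha0.eventually_lt_const (half_pos hη))
    filter_upwards [hm.eventually_ge_atTop N] with j hj i hi using hN i (hj.trans hi)
  filter_upwards [hsmall, eventually_euler_shadows hF hM hq ha hasq hrec hm hpm τ (half_pos hη)]
    with j h1 h2
  obtain ⟨i, hi, hle, hlt⟩ := exists_partition_step hasum (m j) hτ
  refine ⟨i, hi, hle, ?_⟩
  set σ := ∑ k ∈ Finset.range i, a k - ∑ k ∈ Finset.range (m j), a k
  have h3 : ‖q σ - q τ‖ ≤ M * a i := by
    refine (norm_solution_sub_le hM hq τ σ).trans (mul_le_mul_of_nonneg_left ?_ M.coe_nonneg)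
    rw [abs_le]; constructor <;> linarith
  calc ‖p i - q τ‖ ≤ ‖p i - q σ‖ + ‖q σ - q τ‖ := norm_sub_le_norm_sub_add_norm_sub _ _ _
    _ < η := by linarith [h2 i hi hle, h1 i hi]

end Euler

theorem stmt14 {n : ℕ} (Pc U : Set (EuclideanSpace ℝ (Fin n)))
    (hPc : IsCompact Pc) (hU : IsOpen U) (hPcU : Pc ⊆ U)
    (g : EuclideanSpace ℝ (Fin n) → EuclideanSpace ℝ (Fin n))
    (Lg : NNReal) (hg : LipschitzOnWith Lg g U)
    (pdag : EuclideanSpace ℝ (Fin n)) (hpdag : pdag ∈ interior Pc)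
    -- `p†` is the unique zero of `g` in `Pc`
    (hzero : g pdag = 0)
    (huniq : ∀ q ∈ Pc, g q = 0 → q = pdag)
    -- `Pc` is forward invariant for `ṗ = g(p)`
    (hinv : ∀ q : ℝ → EuclideanSpace ℝ (Fin n),
      (∀ t : ℝ, 0 ≤ t → q t ∈ U) → (∀ t : ℝ, 0 ≤ t → HasDerivAt q (g (q t)) t) →
      q 0 ∈ Pc → ∀ t : ℝ, 0 ≤ t → q t ∈ Pc)
    -- `p†` is Lyapunov stable
    (hstable : ∀ ε : ℝ, 0 < ε → ∃ δ : ℝ, 0 < δ ∧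
      ∀ q : ℝ → EuclideanSpace ℝ (Fin n),
        (∀ t : ℝ, 0 ≤ t → q t ∈ U) → (∀ t : ℝ, 0 ≤ t → HasDerivAt q (g (q t)) t) →
        ‖q 0 - pdag‖ < δ → ∀ t : ℝ, 0 ≤ t → ‖q t - pdag‖ < ε)
    -- every solution starting in `U` converges to `p†`
    (hconv : ∀ q : ℝ → EuclideanSpace ℝ (Fin n),
      (∀ t : ℝ, 0 ≤ t → q t ∈ U) → (∀ t : ℝ, 0 ≤ t → HasDerivAt q (g (q t)) t) →
      q 0 ∈ U → Tendsto q atTop (𝓝 pdag))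
    -- the Euler iteration with Robbins–Monro step sizes
    (a : ℕ → ℝ) (ha : ∀ k, 0 < a k)
    (hasum : Tendsto (fun N => ∑ k ∈ Finset.range N, a k) atTop atTop)
    (hasq : Summable (fun k => a k ^ 2))
    (p : ℕ → EuclideanSpace ℝ (Fin n)) (hpmem : ∀ k, p k ∈ Pc)
    (hrec : ∀ k, p (k + 1) = p k + a k • g (p k)) :
    Tendsto p atTop (𝓝 pdag) := by
  set t : ℕ → ℝ := fun N => ∑ k ∈ Finset.range N, a k
  have htmono : Monotone t := fun i j hij =>
    Finset.sum_le_sum_of_subset_of_nonneg (Finset.range_mono hij) fun k _ _ => (ha k).le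
  obtain ⟨B, hB⟩ := hPc.exists_bound_of_continuousOn (hg.continuousOn.mono hPcU)
  obtain ⟨K, M, F, hF, hM, hFg⟩ := exists_bounded_lipschitz_extension (hg.mono hPcU) hB
  have hrecF : ∀ k, p (k + 1) = p k + a k • F (p k) := fun k => by
    rw [hFg (hpmem k)]; exact hrec k
  -- limits of iterates start genuine solutions, which the iteration shadows
  have hlimit : ∀ m : ℕ → ℕ, Tendsto m atTop atTop →
      ∃ (φ : ℕ → ℕ) (q : ℝ → EuclideanSpace ℝ (Fin n)), StrictMono φ ∧
        Tendsto (fun j => p (m (φ j))) atTop (𝓝 (q 0)) ∧ (∀ s, HasDerivAt q (F (q s)) s) ∧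
        (∀ s, 0 ≤ s → q s ∈ U) ∧ (∀ s, 0 ≤ s → HasDerivAt q (g (q s)) s) := by
    intro m hm
    obtain ⟨y, -, φ, hφ, hy⟩ := hPc.tendsto_subseq fun j => hpmem (m j)
    obtain ⟨q, hq0, hq⟩ := exists_global_solution_of_lipschitz_of_bounded hF hM y
    have hy' : Tendsto (fun j => p (m (φ j))) atTop (𝓝 (q 0)) := hq0 ▸ hy
    have hmem : ∀ s, 0 ≤ s → q s ∈ Pc := by
      intro s hs
      rw [← hPc.isClosed.closure_eq, Metric.mem_closure_iff]
      intro η hη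
      obtain ⟨j, i, -, -, hi⟩ := (eventually_exists_euler_near hF hM hq ha hasum hasq hrecF
        (hm.comp hφ.tendsto_atTop) hy' hs hη).exists
      exact ⟨p i, hpmem i, by rwa [dist_comm, dist_eq_norm]⟩
    exact ⟨φ, q, hφ, hy', hq, fun s hs => hPcU (hmem s hs), fun s hs => hFg (hmem s hs) ▸ hq s⟩
  rw [Metric.tendsto_atTop]
  by_contra! hcon
  obtain ⟨ε, hε, hbad⟩ := hcon
  obtain ⟨δ, hδ, hstab⟩ := hstable (ε / 2) (half_pos hε)
  -- near-equilibrium iterates recur within bounded time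
  have hrecur : ∃ T : ℕ, ∀ k, T ≤ k → ∃ j, k ≤ j ∧ t j - t k ≤ T ∧ ‖p j - pdag‖ < δ / 2 := by
    by_contra! hno
    choose m hmge hm using hno
    have hmtop : Tendsto m atTop atTop := tendsto_atTop_mono hmge tendsto_id
    obtain ⟨φ, q, hφ, hy, hq, hqU, hqg⟩ := hlimit m hmtop
    have hqlim := hconv q hqU hqg (hqU 0 le_rfl)
    obtain ⟨τ, hτ, hτ0⟩ := (((Metric.tendsto_nhds.1 hqlim) (δ / 4) (by linarith)).and
      (eventually_ge_atTop (0 : ℝ))).exists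
    obtain ⟨j, ⟨i, hi, hiτ, hin⟩, hjτ⟩ := ((eventually_exists_euler_near hF hM hq ha hasum hasq
      hrecF (hmtop.comp hφ.tendsto_atTop) hy hτ0 (show 0 < δ / 4 by linarith)).and
      (tendsto_natCast_atTop_atTop.comp hφ.tendsto_atTop |>.eventually_ge_atTop τ)).exists
    have h1 := hm (φ j) i hi (hiτ.trans hjτ)
    rw [dist_eq_norm] at hτ
    linarith [norm_sub_le_norm_sub_add_norm_sub (p i) (q τ) pdag]
  obtain ⟨T, hT⟩ := hrecur
  have ha1 : ∀ᶠ k in atTop, a k < 1 := by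
    filter_upwards [hasq.tendsto_atTop_zero.eventually_lt_const one_pos] with k hk
    nlinarith [ha k]
  obtain ⟨N₁, hN₁⟩ := eventually_atTop.1 ha1
  -- each excursion is preceded by a near-equilibrium iterate a bounded time earlier
  have hexc : ∀ N : ℕ, ∃ j k, N ≤ j ∧ j ≤ k ∧ ‖p j - pdag‖ < δ / 2 ∧ ε ≤ ‖p k - pdag‖ ∧
      t k - t j ≤ T + 1 := by
    intro N
    obtain ⟨j₀, hj₀, -, hgood₀⟩ := hT (max N (max T N₁)) (by simp)
    obtain ⟨k, hk, hkbad⟩ := hbad j₀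
    rw [dist_eq_norm] at hkbad
    classical
    let P : ℕ → Prop := fun j => ‖p j - pdag‖ < δ / 2
    have hjP : P (Nat.findGreatest P k) := Nat.findGreatest_spec (P := P) hk hgood₀
    have hj₀j : j₀ ≤ Nat.findGreatest P k := Nat.le_findGreatest hk hgood₀
    have hjk : Nat.findGreatest P k ≤ k := Nat.findGreatest_le k
    have hmax : ∀ i, Nat.findGreatest P k < i → i ≤ k → ¬ P i :=
      fun i h1 h2 => Nat.findGreatest_is_greatest h1 h2
    generalize Nat.findGreatest P k = j at hjP hj₀j hjk hmax
    obtain ⟨i, hji, hti, hiP⟩ := hT (j + 1) (by omega)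
    have hki : k < i := by
      by_contra! h
      exact hmax i (by omega) h hiP
    refine ⟨j, k, by omega, hjk, hjP, hkbad, ?_⟩
    have e : t (j + 1) = t j + a j := Finset.sum_range_succ _ _
    linarith [htmono hki.le, hN₁ j (by omega)]
  choose j k hNj hjk hgood hbadk htime using hexc
  have hjtop : Tendsto j atTop atTop := tendsto_atTop_mono hNj tendsto_id
  obtain ⟨φ, q, hφ, hy, hq, hqU, hqg⟩ := hlimit j hjtop
  have hq0 : ‖q 0 - pdag‖ < δ := by
    have : ‖q 0 - pdag‖ ≤ δ / 2 :=
      le_of_tendsto (hy.sub_const pdag).norm (Eventually.of_forall fun i => (hgood (φ i)).le)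
    linarith
  obtain ⟨i, hi⟩ := (eventually_euler_shadows hF hM hq ha hasq hrecF
    (hjtop.comp hφ.tendsto_atTop) hy (T + 1) (half_pos hε)).exists
  have h1 := hi (k (φ i)) (hjk _) (htime _)
  have h2 := hstab q hqU hqg hq0 (t (k (φ i)) - t (j (φ i))) (sub_nonneg.2 (htmono (hjk _)))
  have h3 := norm_sub_le_norm_sub_add_norm_sub (p (k (φ i)))
    (q (t (k (φ i)) - t (j (φ i)))) pdag
  have h4 := hbadk (φ i)
  simp only [Function.comp_apply] at h1
  linarith
end

section
/- Let P_c ⊂ ℝⁿ be compact, let g : ℝⁿ → ℝⁿ be L_g-Lipschitz with ‖g(p)‖ ≤ B for p in the convex hull of P_c, and let (p_k)_{k≥0} ⊂ P_c satisfy p_{k+1} = p_k + a_k g(p_k), where a_k > 0, a_k → 0, and Σ_k a_k = ∞. Set t_k = Σ_{j<k} a_j, and let p̄ : [0,∞) → ℝⁿ be the piecewise-linear interpolation defined by p̄(t) = p_k + ((t − t_k)/a_k)(p_{k+1} − p_k) for t ∈ [t_k, t_{k+1}]. For each n, let pⁿ(t) denote the solution of ṗ = g(p) with pⁿ(0) =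 p_n. Then for every T > 0, sup_{t ∈ [0,T]} ‖p̄(t_n + t) − pⁿ(t)‖ → 0 as n → ∞. -/
open Filter Topology

theorem gronwallBound_gronwallBound (δ K ε x y : ℝ) :
    gronwallBound (gronwallBound δ K ε x) K ε y = gronwallBound δ K ε (x + y) := by
  by_cases hK : K = 0
  · subst hK
    simp only [gronwallBound_K0]
    ring
  · simp only [gronwallBound_of_K_ne_0 hK, mul_add, Real.exp_add]
    ring

section EulerMethod

variable {E : Type*} [NormedAddCommGroup E] [NormedSpace ℝ E]

/-- On a single step, the distance between an Euler segment and an exact solution obeys the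
Grönwall bound. -/
theorem dist_euler_step_le_gronwallBound {g : E → E} {K : NNReal} (hg : LipschitzWith K g)
    {x : E} {u : ℝ → E} {s h δ ε : ℝ} (hε : K * (h * ‖g x‖) ≤ ε)
    (hu : ∀ t, HasDerivAt u (g (u t)) t) (h0 : dist x (u s) ≤ δ) :
    ∀ t ∈ Set.Icc s (s + h), dist (x + (t - s) • g x) (u t) ≤ gronwallBound δ K ε (t - s) := by
  have hf : ∀ t, HasDerivAt (fun t => x + (t - s) • g x) (g x) t := fun t => by
    simpa using (((hasDerivAt_id t).sub_const s).smul_const (g x)).const_add x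
  have key := dist_le_of_approx_trajectories_ODE (v := fun _ => g) (K := K) (a := s) (b := s + h)
    (f := fun t => x + (t - s) • g x) (f' := fun _ => g x) (g := u) (g' := fun t => g (u t))
    (εf := ε) (εg := 0) (δ := δ) (fun _ => hg)
    (fun t _ => (hf t).continuousAt.continuousWithinAt) (fun t _ => (hf t).hasDerivWithinAt)
    (fun t ht => ?_) (fun t _ => (hu t).continuousAt.continuousWithinAt)
    (fun t _ => (hu t).hasDerivWithinAt) (fun t _ => (dist_self _).le) (by simpa using h0)
  · simpa using key
  · have hts : 0 ≤ t - s := sub_nonneg.2 ht.1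
    calc dist (g x) (g (x + (t - s) • g x)) ≤ K * dist x (x + (t - s) • g x) := hg.dist_le_mul _ _
      _ = K * ((t - s) * ‖g x‖) := by
        rw [dist_self_add_right, norm_smul, Real.norm_of_nonneg hts]
      _ ≤ K * (h * ‖g x‖) := by
        gcongr
        linarith [ht.2]
      _ ≤ ε := hε

/-- The interpolated Euler scheme started at step `m` stays within the Grönwall bound of the exact
solution with the same initial value. -/
theorem dist_euler_interpolation_le_gronwallBound {g : E → E} {K : NNReal}
    (hg : LipschitzWith K g) {a τ : ℕ → ℝ} {p : ℕ → E} {q u : ℝ → E} {m : ℕ} {ε : ℝ}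
    (ha : ∀ k, 0 ≤ a k) (hτ : ∀ k, τ (k + 1) = τ k + a k)
    (hq : ∀ k, ∀ t ∈ Set.Icc (τ k) (τ (k + 1)), q t = p k + (t - τ k) • g (p k))
    (hε : ∀ k ≥ m, K * (a k * ‖g (p k)‖) ≤ ε)
    (hu0 : u (τ m) = p m) (hu : ∀ t, HasDerivAt u (g (u t)) t) {k : ℕ} (hk : m ≤ k) :
    ∀ t ∈ Set.Icc (τ m) (τ k), dist (q t) (u t) ≤ gronwallBound 0 K ε (t - τ m) := by
  have hmono : Monotone τ := monotone_nat_of_le_succ fun k => by linarith [hτ k, ha k]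
  have hqp : ∀ k, q (τ k) = p k := fun k => by
    rw [hq k _ ⟨le_rfl, hmono k.le_succ⟩]
    simp
  induction k, hk using Nat.le_induction with
  | base =>
    intro t ht
    obtain rfl : t = τ m := le_antisymm ht.2 ht.1
    simp [hqp, hu0, gronwallBound_x0]
  | succ k hk ih =>
    intro t ht
    rcases le_total t (τ k) with htk | htk
    · exact ih t ⟨ht.1, htk⟩
    · have h0 := ih (τ k) ⟨hmono hk, le_rfl⟩
      rw [hqp] at h0
      have := dist_euler_step_le_gronwallBound hg (hε k hk) hu h0 t ⟨htk, hτ k ▸ ht.2⟩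
      rwa [gronwallBound_gronwallBound, ← hq k t ⟨htk, ht.2⟩,
        show τ k - τ m + (t - τ k) = t - τ m by ring] at this

end EulerMethod

theorem stmt15 {n : ℕ} (Pc : Set (EuclideanSpace ℝ (Fin n))) (hPc : IsCompact Pc)
    (g : EuclideanSpace ℝ (Fin n) → EuclideanSpace ℝ (Fin n))
    (Lg : NNReal) (hg : LipschitzWith Lg g)
    (B : ℝ) (hB : ∀ q ∈ convexHull ℝ Pc, ‖g q‖ ≤ B)
    (a : ℕ → ℝ) (ha : ∀ k, 0 < a k) (ha0 : Tendsto a atTop (𝓝 0))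
    (hasum : Tendsto (fun N => ∑ k ∈ Finset.range N, a k) atTop atTop)
    (p : ℕ → EuclideanSpace ℝ (Fin n)) (hpmem : ∀ k, p k ∈ Pc)
    (hrec : ∀ k, p (k + 1) = p k + a k • g (p k))
    -- `t_k = Σ_{j<k} a_j` and `p̄` is the piecewise-linear interpolation of `(p_k)`
    (tseq : ℕ → ℝ) (htseq : ∀ k, tseq k = ∑ j ∈ Finset.range k, a j)
    (pbar : ℝ → EuclideanSpace ℝ (Fin n))
    (hpbar : ∀ k, ∀ t ∈ Set.Icc (tseq k) (tseq (k + 1)),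
      pbar t = p k + ((t - tseq k) / a k) • (p (k + 1) - p k))
    -- `pⁿ` is the solution of `ṗ = g(p)` with `pⁿ(0) = p_n`
    (psol : ℕ → ℝ → EuclideanSpace ℝ (Fin n))
    (hsol0 : ∀ n', psol n' 0 = p n')
    (hsol : ∀ n', ∀ t : ℝ, HasDerivAt (psol n') (g (psol n' t)) t) :
    ∀ T : ℝ, 0 < T → ∀ ε : ℝ, 0 < ε → ∃ N : ℕ, ∀ n' ≥ N,
      ∀ t ∈ Set.Icc (0 : ℝ) T, ‖pbar (tseq n' + t) - psol n' t‖ ≤ ε := by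
  intro T hT ε hε
  have hτ : ∀ k, tseq (k + 1) = tseq k + a k := fun k => by
    rw [htseq, htseq, Finset.sum_range_succ]
  have hgB : ∀ k, ‖g (p k)‖ ≤ B := fun k => hB _ (subset_convexHull ℝ Pc (hpmem k))
  have hq : ∀ k, ∀ t ∈ Set.Icc (tseq k) (tseq (k + 1)),
      pbar t = p k + (t - tseq k) • g (p k) := fun k t ht => by
    rw [hpbar k t ht, hrec, add_sub_cancel_left, smul_smul, div_mul_cancel₀ _ (ha k).ne']
  obtain ⟨δ, hδ, hδε⟩ : ∃ δ > 0, gronwallBound 0 Lg δ T < ε := by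
    have h := (gronwallBound_continuous_ε 0 Lg T).tendsto 0
    rw [gronwallBound_ε0_δ0] at h
    have h' := (h.mono_left (nhdsWithin_le_nhds (s := Set.Ioi 0))).eventually (gt_mem_nhds hε)
    exact (eventually_mem_nhdsWithin.and h').exists
  have hstep : Tendsto (fun k => Lg * (a k * B)) atTop (𝓝 0) := by
    simpa using (ha0.mul_const B).const_mul (Lg : ℝ)
  obtain ⟨N, hN⟩ := eventually_atTop.1 (hstep.eventually (ge_mem_nhds hδ))
  refine ⟨N, fun m hm t ht => ?_⟩
  have hτtop : Tendsto tseq atTop atTop := by simpa only [← htseq] using hasum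
  obtain ⟨k, hk, hmk⟩ :=
    ((hτtop.eventually_ge_atTop (tseq m + t)).and (eventually_ge_atTop m)).exists
  have key := dist_euler_interpolation_le_gronwallBound hg (u := fun s => psol m (s - tseq m))
    (ε := δ) (fun k => (ha k).le) hτ hq
    (fun j hj => le_trans (by gcongr; exacts [(ha j).le, hgB j]) (hN j (hm.trans hj)))
    (by simp [hsol0]) (fun s => (hsol m (s - tseq m)).comp_sub_const s (tseq m)) hmk
    (tseq m + t) ⟨by linarith [ht.1], hk⟩
  rw [dist_eq_norm, add_sub_cancel_left] at key
  exact (key.trans (gronwallBound_mono le_rfl hδ.le Lg.coe_nonneg ht.2)).trans hδε.le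
end
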